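/- (Labourie–Zimmer) Let n and k be integers with k ≥ 3 and n ≥ k + 2, and let H be the subgroup of SL(n,ℝ) consisting of block matrices diag(A, I_k) with A ∈ SL(n−k,ℝ). Then there is no discrete subgroup Γ of SL(n,ℝ) whose action by left multiplication on the coset space SL(n,ℝ)/H is free, properly discontinuous and cocompact; i.e., the homogeneous space SL(n−k,ℝ)\SL(n,ℝ) admits no compact Clifford–Klein form for k ≥ 3. -/

import Mathlib

open Matrix

/-- The matrix topology on `SL(n, ℝ)`, induced from the space of matrices. -/
noncomputable instance (n : ℕ) : TopologicalSpace (Matrix.SpecialLinearGroup (Fin n) ℝ) :=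
  TopologicalSpace.induced (fun g => (g : Matrix (Fin n) (Fin n) ℝ)) inferInstance

set_option linter.unusedSimpArgs false
set_option linter.unusedSectionVars false


section Topological

variable {m : Type*} [Fintype m] [DecidableEq m]

/-- The transition matrix between two idempotents. -/
def transU (P P' : Matrix m m ℝ) : Matrix m m ℝ := P' * P + (1 - P') * (1 - P)

/-- Product of transition matrices along a subdivision. -/
noncomputable def transO (P : ℝ → ℝ → Matrix m m ℝ) (L : ℕ) (s : ℝ) : ℕ → Matrix m m ℝ
  | 0 => 1
  | j + 1 => transU (P s (j / L)) (P s ((j + 1 : ℕ) / L)) * transO P L s j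

theorem transU_mul {P P' : Matrix m m ℝ} (h : P * P = P) (h' : P' * P' = P') :
    transU P P' * P = P' * transU P P' := by
  unfold transU
  simp only [add_mul, mul_add, sub_mul, mul_sub, one_mul, mul_one, mul_assoc, h]
  simp only [← mul_assoc, h']
  abel

theorem transU_self {P : Matrix m m ℝ} (h : P * P = P) : transU P P = 1 := by
  unfold transU
  simp only [sub_mul, mul_sub, one_mul, mul_one, h]
  abel

theorem projection_contra (R : Matrix m m ℝ) (hR : R * R = 1) (hdet : R.det = -1)
    (P : ℝ → ℝ → Matrix m m ℝ) (hc : Continuous (fun x : ℝ × ℝ => P x.1 x.2))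
    (hP : ∀ s t, P s t * P s t = P s t)
    (h1 : ∀ s, P s 1 = R * P s 0 * R)
    (h2 : ∀ t, P 1 t = R * (1 - P 0 t) * R) : False := by
  have hcU : Continuous (fun x : ℝ × ℝ × ℝ => (transU (P x.1 x.2.1) (P x.1 x.2.2)).det) := by
    unfold transU
    have e1 : Continuous (fun x : ℝ × ℝ × ℝ => P x.1 x.2.1) :=
      hc.comp (f := fun x : ℝ × ℝ × ℝ => (x.1, x.2.1)) (by fun_prop)
    have e2 : Continuous (fun x : ℝ × ℝ × ℝ => P x.1 x.2.2) :=
      hc.comp (f := fun x : ℝ × ℝ × ℝ => (x.1, x.2.2)) (by fun_prop)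
    apply Continuous.matrix_det
    fun_prop
  have hδ : ∃ δ > 0, ∀ s ∈ Set.Icc (0:ℝ) 1, ∀ t ∈ Set.Icc (0:ℝ) 1, ∀ t' ∈ Set.Icc (0:ℝ) 1,
      |t' - t| < δ → 0 < (transU (P s t) (P s t')).det := by
    have hcomp : IsCompact (Set.Icc (0:ℝ) 1 ×ˢ Set.Icc (0:ℝ) 1 ×ˢ Set.Icc (0:ℝ) 1) :=
      isCompact_Icc.prod (isCompact_Icc.prod isCompact_Icc)
    have hu := hcomp.uniformContinuousOn_of_continuous hcU.continuousOn
    rw [Metric.uniformContinuousOn_iff] at hu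
    obtain ⟨δ, hδ, h⟩ := hu 1 one_pos
    refine ⟨δ, hδ, fun s hs t ht t' ht' htt => ?_⟩
    have := h (s, t, t') ⟨hs, ht, ht'⟩ (s, t, t) ⟨hs, ht, ht⟩ (by
      simp only [Prod.dist_eq, dist_self, Real.dist_eq]
      simp [htt])
    simp only [transU_self (hP s t), Matrix.det_one, Real.dist_eq] at this
    have := (abs_lt.1 this).1
    linarith
  obtain ⟨δ, hδ, hpos⟩ := hδ
  obtain ⟨L0, hL0⟩ := exists_nat_one_div_lt hδ
  set L := L0 + 1 with hL
  have hLpos : (0:ℝ) < L := by positivity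
  set O := transO P L with hO
  have hOdet : ∀ s ∈ Set.Icc (0:ℝ) 1, ∀ j ≤ L, 0 < (O s j).det := by
    intro s hs j
    induction j with
    | zero => intro _; simp [hO, transO]
    | succ j ih =>
      intro hj
      have := ih (by omega)
      simp only [hO, transO, Matrix.det_mul]
      refine mul_pos ?_ this
      have hj1 : ((j + 1 : ℕ) : ℝ) ≤ L := by exact_mod_cast hj
      have hj0 : (j : ℝ) ≤ L := by push_cast at hj1; linarith
      apply hpos s hs _ ⟨by positivity, by rw [div_le_one hLpos]; exact hj0⟩ _
        ⟨by positivity, by rw [div_le_one hLpos]; exact hj1⟩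
      rw [← sub_div]; push_cast
      rw [add_sub_cancel_left, abs_of_pos (by positivity)]
      simpa [hL] using hL0
  have hOint : ∀ s j, O s j * P s 0 = P s (j / L) * O s j := by
    intro s j
    induction j with
    | zero => simp [hO, transO]
    | succ j ih =>
      simp only [hO, transO] at ih ⊢
      rw [mul_assoc, ih, ← mul_assoc, transU_mul (hP _ _) (hP _ _), mul_assoc]
  have hOc : ∀ j, Continuous (fun s => O s j) := by
    intro j
    induction j with
    | zero => simp only [hO, transO]; exact continuous_const
    | succ j ih =>
      simp only [hO, transO, transU] at ih ⊢
      have e : ∀ t, Continuous (fun s => P s t) := fun t =>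
        hc.comp (f := fun x : ℝ => (x, t)) (by fun_prop)
      have e1 := e (j / L)
      have e2 := e ((j + 1 : ℕ) / L)
      fun_prop
  have hRR : ∀ X : Matrix m m ℝ, R * (R * X) = X := fun X => by rw [← mul_assoc, hR, one_mul]
  have hO1 : ∀ j, O 1 j = R * O 0 j * R := by
    intro j
    induction j with
    | zero => simp [hO, transO, hR]
    | succ j ih =>
      simp only [hO, transO] at ih ⊢
      rw [ih, h2, h2, transU, transU]
      simp only [mul_add, add_mul, mul_sub, sub_mul, mul_one, one_mul, mul_assoc, hRR, hR]
      abel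
  set Q : ℝ → Matrix m m ℝ := fun s => R * O s L with hQ
  have hQcomm : ∀ s, Q s * P s 0 = P s 0 * Q s := by
    intro s
    have := hOint s L
    rw [div_self hLpos.ne', h1] at this
    simp only [hQ]
    rw [mul_assoc, this]
    simp only [mul_assoc, hRR]
  have hQdet : ∀ s ∈ Set.Icc (0:ℝ) 1, (Q s).det < 0 := by
    intro s hs
    simp only [hQ, Matrix.det_mul, hdet]
    have := hOdet s hs L le_rfl
    linarith
  set fp : ℝ → ℝ := fun s => (Q s * P s 0 + (1 - P s 0)).det with hfp
  set fm : ℝ → ℝ := fun s => (Q s * (1 - P s 0) + P s 0).det with hfm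
  have hprod : ∀ s, fp s * fm s = (Q s).det := by
    intro s
    simp only [hfp, hfm]
    rw [← Matrix.det_mul]
    congr 1
    have hPP := hP s 0
    have e : ∀ X, P s 0 * (P s 0 * X) = P s 0 * X := fun X => by rw [← mul_assoc, hPP]
    have e2 : ∀ X, P s 0 * (Q s * X) = Q s * (P s 0 * X) := fun X => by
      rw [← mul_assoc, ← hQcomm, mul_assoc]
    simp only [mul_add, add_mul, mul_sub, sub_mul, mul_one, one_mul, mul_assoc, e2, hPP,
      ← hQcomm]
    abel
  have hf1 : fp 1 = fm 0 := by
    simp only [hfp, hfm]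
    have : Q 1 * P 1 0 + (1 - P 1 0) = R * (Q 0 * (1 - P 0 0) + P 0 0) * R := by
      simp only [hQ]
      rw [hO1, h2]
      simp only [mul_add, add_mul, mul_sub, sub_mul, mul_one, one_mul, mul_assoc, hRR, hR]
      abel
    rw [this, Matrix.det_mul, Matrix.det_mul, hdet]; ring
  have hfc : Continuous fp := by
    apply Continuous.matrix_det
    have e : Continuous (fun s => P s 0) := hc.comp (f := fun x : ℝ => (x, (0:ℝ))) (by fun_prop)
    have := hOc L
    simp only [hQ]
    fun_prop
  have hne : ∀ s ∈ Set.Icc (0:ℝ) 1, fp s ≠ 0 := by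
    intro s hs h0
    have := hprod s
    rw [h0, zero_mul] at this
    exact (hQdet s hs).ne this.symm
  have hneg : fp 0 * fp 1 < 0 := by
    rw [hf1, hprod]; exact hQdet 0 ⟨le_rfl, zero_le_one⟩
  rcases mul_neg_iff.1 hneg with ⟨ha, hb⟩ | ⟨ha, hb⟩
  · obtain ⟨s, hs, h0⟩ := intermediate_value_Icc' zero_le_one hfc.continuousOn ⟨hb.le, ha.le⟩
    exact hne s hs h0
  · obtain ⟨s, hs, h0⟩ := intermediate_value_Icc zero_le_one hfc.continuousOn ⟨ha.le, hb.le⟩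
    exact hne s hs h0

end Topological

section MatAbs

open scoped Matrix.Norms.L2Operator MatrixOrder

theorem exists_matAbs (m : Type*) [Fintype m] [DecidableEq m] :
    ∃ A : Matrix m m ℝ → Matrix m m ℝ, Continuous A ∧
      (∀ K, Kᵀ = K → A K * A K = K * K) ∧
      (∀ K, Kᵀ = K → A K * K = K * A K) ∧ (∀ K, A (-K) = A K) ∧
      ∀ R, Rᵀ = R → R * R = 1 → ∀ K, A (R * K * R) = R * A K * R := by
  have hst : ∀ K : Matrix m m ℝ, star K = Kᵀ := fun K => by
    rw [Matrix.star_eq_conjTranspose, Matrix.conjTranspose_eq_transpose_of_trivial]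
  refine ⟨CFC.abs, CFC.continuous_abs, ?_, ?_, ?_, ?_⟩
  · intro K hK
    rw [CFC.abs_mul_abs, hst, hK]
  · intro K hK
    have : IsSelfAdjoint K := by rw [IsSelfAdjoint, hst, hK]
    exact CFC.commute_abs_self K this.isStarNormal
  · intro K
    exact CFC.abs_neg K
  · intro R hR hRR K
    apply CFC.sqrt_unique
    · have e : ∀ X, R * (R * X) = X := fun X => by rw [← mul_assoc, hRR, one_mul]
      have : CFC.abs K * (CFC.abs K * R) = Kᵀ * (K * R) := by
        rw [← mul_assoc, CFC.abs_mul_abs, hst, mul_assoc]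
      simp only [hst, Matrix.transpose_mul, hR, mul_assoc, e, this]
    · have h := CFC.abs_nonneg K
      have := star_left_conjugate_nonneg h R
      rwa [hst, hR] at this

end MatAbs

section Topological2

variable {m : Type*} [Fintype m] [DecidableEq m]

theorem symmetric_family_contra (R : Matrix m m ℝ) (hR : R * R = 1) (hRT : Rᵀ = R)
    (hdet : R.det = -1) (K : ℝ → ℝ → Matrix m m ℝ)
    (hc : Continuous (fun x : ℝ × ℝ => K x.1 x.2))
    (hsym : ∀ s t, (K s t)ᵀ = K s t)
    (hinv : ∀ s ∈ Set.Icc (0:ℝ) 1, ∀ t, (K s t).det ≠ 0)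
    (h1 : ∀ s, K s 1 = R * K s 0 * R)
    (h2 : ∀ t, K 1 t = -(R * K 0 t * R)) : False := by
  obtain ⟨A, hAc, hAA, hAK, hAn, hAR⟩ := exists_matAbs m
  set cl : ℝ → ℝ := fun s => max 0 (min s 1) with hcl
  have hclc : Continuous cl := by fun_prop
  have hclm : ∀ s, cl s ∈ Set.Icc (0:ℝ) 1 := fun s =>
    ⟨le_max_left _ _, max_le zero_le_one (min_le_right _ _)⟩
  have hcl0 : cl 0 = 0 := by simp [hcl]
  have hcl1 : cl 1 = 1 := by simp [hcl]
  have hu : ∀ s t, IsUnit (K (cl s) t).det := fun s t => (hinv _ (hclm s) t).isUnit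
  have hRinv : R⁻¹ = R := Matrix.inv_eq_left_inv hR
  have hcomm : ∀ s t, (K (cl s) t)⁻¹ * A (K (cl s) t) = A (K (cl s) t) * (K (cl s) t)⁻¹ := by
    intro s t
    have := hAK _ (hsym (cl s) t)
    calc (K (cl s) t)⁻¹ * A (K (cl s) t)
        = (K (cl s) t)⁻¹ * (A (K (cl s) t) * K (cl s) t) * (K (cl s) t)⁻¹ := by
          rw [mul_assoc, mul_assoc, Matrix.mul_nonsing_inv _ (hu s t), mul_one]
      _ = _ := by rw [this, ← mul_assoc, Matrix.nonsing_inv_mul _ (hu s t), one_mul]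
  refine projection_contra R hR hdet
    (fun s t => (1/2 : ℝ) • (1 + (K (cl s) t)⁻¹ * A (K (cl s) t))) ?_ ?_ ?_ ?_
  · have hK' : Continuous (fun x : ℝ × ℝ => K (cl x.1) x.2) :=
      hc.comp (f := fun x : ℝ × ℝ => (cl x.1, x.2)) (by fun_prop)
    have hi : Continuous (fun x : ℝ × ℝ => (K (cl x.1) x.2)⁻¹) := by
      simp only [Matrix.inv_def, Ring.inverse_eq_inv']
      have hd : Continuous (fun x : ℝ × ℝ => ((K (cl x.1) x.2).det)⁻¹) :=
        hK'.matrix_det.inv₀ fun x => hinv _ (hclm _) _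
      exact hd.smul hK'.matrix_adjugate
    have hA' := hAc.comp hK'
    simp only [Function.comp_def] at hA'
    fun_prop
  · intro s t
    have e : (K (cl s) t)⁻¹ * A (K (cl s) t) * ((K (cl s) t)⁻¹ * A (K (cl s) t)) = 1 := by
      nth_rewrite 1 [hcomm]
      rw [mul_assoc, ← mul_assoc _ _ (A _), ← mul_assoc, ← mul_assoc, ]
      have h := hAA _ (hsym (cl s) t)
      have h3 : A (K (cl s) t) * (K (cl s) t)⁻¹ * (K (cl s) t)⁻¹ * A (K (cl s) t)
          = (K (cl s) t)⁻¹ * ((K (cl s) t)⁻¹ * (A (K (cl s) t) * A (K (cl s) t))) := by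
        rw [← hcomm, mul_assoc _ (A _) , ← hcomm]; simp only [mul_assoc]
      rw [h3, h, ← mul_assoc _ (K _ _), Matrix.nonsing_inv_mul _ (hu s t), one_mul,
        Matrix.nonsing_inv_mul _ (hu s t)]
    simp only [smul_mul_assoc, mul_smul_comm, smul_smul, add_mul, mul_add, e, one_mul, mul_one]
    module
  · intro s
    simp only [h1, hAR R hRT hR, Matrix.mul_inv_rev, hRinv]
    have e : ∀ X, R * (R * X) = X := fun X => by rw [← mul_assoc, hR, one_mul]
    simp only [mul_assoc, e, mul_smul_comm, smul_mul_assoc, mul_add, add_mul, one_mul, hR]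
  · intro t
    have hni : (-(R * K 0 t * R))⁻¹ = -(R * (K 0 t)⁻¹ * R) := by
      apply Matrix.inv_eq_left_inv
      have e : ∀ X, R * (R * X) = X := fun X => by rw [← mul_assoc, hR, one_mul]
      have := hu 0 t
      rw [hcl0] at this
      have h4 : (K 0 t)⁻¹ * (K 0 t * R) = R := by
        rw [← mul_assoc, Matrix.nonsing_inv_mul _ this, one_mul]
      simp only [mul_assoc, e, neg_mul, mul_neg, neg_neg, h4, hR]
    simp only [hcl0, hcl1, h2, hAn, hAR R hRT hR, hni]
    have e : ∀ X, R * (R * X) = X := fun X => by rw [← mul_assoc, hR, one_mul]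
    simp only [mul_assoc, e, mul_smul_comm, smul_mul_assoc, mul_add, add_mul, one_mul, mul_one,
      hR, mul_sub, sub_mul, neg_mul]
    module

end Topological2

section Geo1

/-- Shorthand for `SL(n, ℝ)`. -/
abbrev SLn (n : ℕ) := Matrix.SpecialLinearGroup (Fin n) ℝ

variable {n : ℕ}

theorem sl_mul_inv (g : SLn n) : g.1 * (g⁻¹).1 = 1 := by
  rw [← Matrix.SpecialLinearGroup.coe_mul, mul_inv_cancel]; rfl

theorem sl_inv_mul (g : SLn n) : (g⁻¹).1 * g.1 = 1 := by
  rw [← Matrix.SpecialLinearGroup.coe_mul, inv_mul_cancel]; rfl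

theorem sl_inv_of_mul {g : SLn n} {X : Matrix (Fin n) (Fin n) ℝ} (h : X * g.1 = 1) :
    (g⁻¹).1 = X := by
  have : X * (g.1 * (g⁻¹).1) = (g⁻¹).1 := by rw [← mul_assoc, h, one_mul]
  rw [← this, sl_mul_inv, mul_one]

theorem continuous_slCoe : Continuous (fun g : SLn n => g.1) := continuous_induced_dom

theorem continuous_slCoe_inv : Continuous (fun g : SLn n => (g⁻¹).1) := by
  have : (fun g : SLn n => (g⁻¹).1) = fun g => g.1.adjugate := by
    ext g; rw [Matrix.SpecialLinearGroup.coe_inv]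
  rw [this]
  exact continuous_slCoe.matrix_adjugate

theorem continuous_sl_of {X : Type*} [TopologicalSpace X] {f : X → SLn n}
    (h : Continuous fun x => (f x).1) : Continuous f := continuous_induced_rng.2 h

theorem continuous_sl_mul_left (a : SLn n) : Continuous (fun g : SLn n => a * g) := by
  apply continuous_sl_of
  simp only [Matrix.SpecialLinearGroup.coe_mul]
  have := continuous_slCoe (n := n)
  fun_prop

theorem isCompact_matBox (R : ℝ) :
    IsCompact {A : Matrix (Fin n) (Fin n) ℝ | ∀ i j, |A i j| ≤ R} := by
  have h : IsCompact (Set.univ.pi fun _ : Fin n => Set.univ.pi fun _ : Fin n => Set.Icc (-R) R) :=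
    isCompact_univ_pi fun _ => isCompact_univ_pi fun _ => isCompact_Icc
  have e : {A : Matrix (Fin n) (Fin n) ℝ | ∀ i j, |A i j| ≤ R} =
      (Set.univ.pi fun _ : Fin n => Set.univ.pi fun _ : Fin n => Set.Icc (-R) R) := by
    apply Set.ext
    intro A
    simp only [Set.mem_ofPred_eq, abs_le]
    exact ⟨fun h i _ j _ => h i j, fun h i j => h i trivial j trivial⟩
  rw [e]
  exact h

theorem isCompact_slBox (R : ℝ) : IsCompact {g : SLn n | ∀ i j, |g.1 i j| ≤ R} := by
  have hi : Topology.IsInducing (fun g : SLn n => g.1) := ⟨rfl⟩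
  rw [hi.isCompact_iff]
  have : (fun g : SLn n => g.1) '' {g : SLn n | ∀ i j, |g.1 i j| ≤ R} =
      {A : Matrix (Fin n) (Fin n) ℝ | ∀ i j, |A i j| ≤ R} ∩ {A | A.det = 1} := by
    ext A
    constructor
    · rintro ⟨g, hg, rfl⟩
      exact ⟨hg, g.2⟩
    · rintro ⟨h1, h2⟩
      exact ⟨⟨A, h2⟩, h1, rfl⟩
  rw [this]
  exact (isCompact_matBox R).inter_right
    (isClosed_eq (continuous_id.matrix_det) continuous_const)

theorem bound_matBox (F : Matrix (Fin n) (Fin n) ℝ → ℝ) (hF : Continuous F) (R : ℝ) :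
    ∃ C, 0 ≤ C ∧ ∀ A : Matrix (Fin n) (Fin n) ℝ, (∀ i j, |A i j| ≤ R) → |F A| ≤ C := by
  obtain ⟨C, hC⟩ := (isCompact_matBox R).exists_bound_of_continuousOn hF.continuousOn
  exact ⟨max C 0, le_max_right _ _, fun A hA => (hC A hA).trans (le_max_left _ _)⟩

theorem bound_slBox (F : SLn n → Matrix (Fin n) (Fin n) ℝ) (hF : Continuous F) (R : ℝ) :
    ∃ C, 0 ≤ C ∧ ∀ g : SLn n, (∀ i j, |g.1 i j| ≤ R) → ∀ i j, |F g i j| ≤ C := by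
  have : ∀ i j, ∃ C, ∀ g : SLn n, (∀ i j, |g.1 i j| ≤ R) → |F g i j| ≤ C := by
    intro i j
    obtain ⟨C, hC⟩ := (isCompact_slBox (n := n) R).exists_bound_of_continuousOn
      (f := fun g => F g i j) ((hF.matrix_elem i j).continuousOn)
    exact ⟨C, fun g hg => hC g hg⟩
  choose C hC using this
  refine ⟨∑ i, ∑ j, |C i j|, Finset.sum_nonneg fun i _ => Finset.sum_nonneg fun j _ =>
    abs_nonneg _, fun g hg i j => ((hC i j g hg).trans (le_abs_self _)).trans ?_⟩
  refine le_trans ?_ (Finset.single_le_sum (f := fun i => ∑ j, |C i j|)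
    (fun i _ => Finset.sum_nonneg fun j _ => abs_nonneg _) (Finset.mem_univ i))
  exact Finset.single_le_sum (f := fun j => |C i j|)
    (fun j _ => abs_nonneg _) (Finset.mem_univ j)

theorem dot_bound {x y : Fin n → ℝ} {a b : ℝ} (hx : ∀ i, |x i| ≤ a) (hy : ∀ i, |y i| ≤ b) :
    |x ⬝ᵥ y| ≤ n * (a * b) := by
  calc |x ⬝ᵥ y| ≤ ∑ i, |x i * y i| := Finset.abs_sum_le_sum_abs _ _
    _ ≤ ∑ _i : Fin n, a * b := by
        refine Finset.sum_le_sum fun i _ => ?_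
        rw [abs_mul]
        exact mul_le_mul (hx i) (hy i) (abs_nonneg _) ((abs_nonneg _).trans (hx i))
    _ = n * (a * b) := by simp

theorem mulVec_bound {A : Matrix (Fin n) (Fin n) ℝ} {y : Fin n → ℝ} {a b : ℝ}
    (hx : ∀ i j, |A i j| ≤ a) (hy : ∀ i, |y i| ≤ b) (i : Fin n) :
    |(A *ᵥ y) i| ≤ n * (a * b) := dot_bound (hx i) hy

theorem vecMul_bound {A : Matrix (Fin n) (Fin n) ℝ} {y : Fin n → ℝ} {a b : ℝ}
    (hx : ∀ i j, |A i j| ≤ a) (hy : ∀ i, |y i| ≤ b) (i : Fin n) :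
    |(y ᵥ* A) i| ≤ n * (b * a) := dot_bound hy (fun j => hx j i)

theorem mul_bound {A B : Matrix (Fin n) (Fin n) ℝ} {a b : ℝ}
    (hx : ∀ i j, |A i j| ≤ a) (hy : ∀ i j, |B i j| ≤ b) (i j : Fin n) :
    |(A * B) i j| ≤ n * (a * b) := dot_bound (hx i) (fun k => hy k j)

theorem quad_bound {A : Matrix (Fin n) (Fin n) ℝ} {y : Fin n → ℝ} {a b : ℝ}
    (hx : ∀ i j, |A i j| ≤ a) (hy : ∀ i, |y i| ≤ b) :
    y ⬝ᵥ (A *ᵥ y) ≤ n * (b * (n * (a * b))) :=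
  (le_abs_self _).trans (dot_bound hy (mulVec_bound hx hy))

theorem adjugate_bound (R : ℝ) :
    ∃ C, 0 ≤ C ∧ ∀ g : SLn n, (∀ i j, |g.1 i j| ≤ R) → ∀ i j, |(g⁻¹).1 i j| ≤ C :=
  bound_slBox (fun g => (g⁻¹).1) continuous_slCoe_inv R

variable (J : Fin n → Prop) [DecidablePred J]

/-- The diagonal projection onto the `J`-coordinates. -/
def DJ : Matrix (Fin n) (Fin n) ℝ := Matrix.diagonal fun i => if J i then 1 else 0

/-- The exhaustion function. -/
def nu (g : SLn n) : ℝ :=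
  (g.1 * DJ J * g.1ᵀ).trace + ((g⁻¹).1ᵀ * DJ J * (g⁻¹).1).trace

/-- Membership in the subgroup `H`. -/
def InH (g : SLn n) : Prop := ∀ i j, (J i ∨ J j) → g.1 i j = if i = j then 1 else 0

variable {J}

theorem nu_eq (g : SLn n) : nu J g = (∑ i, ∑ j, if J j then (g.1 i j) ^ 2 else 0)
    + ∑ i, ∑ j, if J j then ((g⁻¹).1 j i) ^ 2 else 0 := by
  unfold nu DJ
  congr 1
  · simp only [Matrix.trace, Matrix.diag_apply, Matrix.mul_apply (M := _ * _),
      Matrix.mul_diagonal, Matrix.transpose_apply]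
    refine Finset.sum_congr rfl fun i _ => Finset.sum_congr rfl fun j _ => ?_
    split_ifs <;> ring
  · simp only [Matrix.trace, Matrix.diag_apply, Matrix.mul_apply (M := _ * _),
      Matrix.mul_diagonal, Matrix.transpose_apply]
    refine Finset.sum_congr rfl fun i _ => Finset.sum_congr rfl fun j _ => ?_
    split_ifs <;> ring

theorem nu_continuous : Continuous (nu J : SLn n → ℝ) := by
  unfold nu
  have := continuous_slCoe (n := n)
  have := continuous_slCoe_inv (n := n)
  exact ((by fun_prop : Continuous fun g : SLn n => g.1 * DJ J * g.1ᵀ).matrix_trace).add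
    ((by fun_prop : Continuous fun g : SLn n => (g⁻¹).1ᵀ * DJ J * (g⁻¹).1).matrix_trace)

theorem nu_mul_right (g k : SLn n) (h1 : k.1 * DJ J * k.1ᵀ = DJ J)
    (h2 : (k⁻¹).1ᵀ * DJ J * (k⁻¹).1 = DJ J) : nu J (g * k) = nu J g := by
  unfold nu
  simp only [_root_.mul_inv_rev, Matrix.SpecialLinearGroup.coe_mul, Matrix.transpose_mul]
  congr 2
  · calc _ = g.1 * (k.1 * DJ J * k.1ᵀ) * g.1ᵀ := by simp only [mul_assoc]
      _ = _ := by rw [h1]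
  · calc _ = (g⁻¹).1ᵀ * ((k⁻¹).1ᵀ * DJ J * (k⁻¹).1) * (g⁻¹).1 := by simp only [mul_assoc]
      _ = _ := by rw [h2]

theorem nu_sq_le_col (g : SLn n) {i j : Fin n} (hj : J j) : (g.1 i j) ^ 2 ≤ nu J g := by
  rw [nu_eq]
  have hs : ∀ f : Fin n → Fin n → ℝ, ∀ i, 0 ≤ ∑ j, if J j then (f i j) ^ 2 else 0 :=
    fun f i => Finset.sum_nonneg fun j _ => by split_ifs <;> positivity
  have h1 := Finset.single_le_sum (f := fun j => if J j then (g.1 i j) ^ 2 else 0)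
    (fun j _ => by split_ifs <;> positivity) (Finset.mem_univ j)
  have h2 := Finset.single_le_sum (f := fun i => ∑ j, if J j then (g.1 i j) ^ 2 else 0)
    (fun i _ => hs (fun i j => g.1 i j) i) (Finset.mem_univ i)
  have h3 : 0 ≤ ∑ i, ∑ j, if J j then ((g⁻¹).1 j i) ^ 2 else 0 :=
    Finset.sum_nonneg fun i _ => hs (fun i j => (g⁻¹).1 j i) i
  simp only [hj, if_true] at h1
  linarith

theorem nu_sq_le_row (g : SLn n) {i j : Fin n} (hj : J j) : ((g⁻¹).1 j i) ^ 2 ≤ nu J g := by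
  rw [nu_eq]
  have hs : ∀ f : Fin n → Fin n → ℝ, ∀ i, 0 ≤ ∑ j, if J j then (f i j) ^ 2 else 0 :=
    fun f i => Finset.sum_nonneg fun j _ => by split_ifs <;> positivity
  have h1 := Finset.single_le_sum (f := fun j => if J j then ((g⁻¹).1 j i) ^ 2 else 0)
    (fun j _ => by split_ifs <;> positivity) (Finset.mem_univ j)
  have h2 := Finset.single_le_sum (f := fun i => ∑ j, if J j then ((g⁻¹).1 j i) ^ 2 else 0)
    (fun i _ => hs (fun i j => (g⁻¹).1 j i) i) (Finset.mem_univ i)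
  have h3 : 0 ≤ ∑ i, ∑ j, if J j then (g.1 i j) ^ 2 else 0 :=
    Finset.sum_nonneg fun i _ => hs (fun i j => g.1 i j) i
  simp only [hj, if_true] at h1
  linarith

theorem nu_le (g : SLn n) {C : ℝ} (h1 : ∀ i j, J j → |g.1 i j| ≤ C)
    (h2 : ∀ i j, J j → |(g⁻¹).1 j i| ≤ C) : nu J g ≤ 2 * (n * (n * C ^ 2)) := by
  rw [nu_eq]
  have key : ∀ f : Fin n → Fin n → ℝ, (∀ i j, J j → |f i j| ≤ C) →
      (∑ i, ∑ j, if J j then (f i j) ^ 2 else 0) ≤ n * (n * C ^ 2) := by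
    intro f hf
    calc _ ≤ ∑ _i : Fin n, ∑ _j : Fin n, C ^ 2 := by
          refine Finset.sum_le_sum fun i _ => Finset.sum_le_sum fun j _ => ?_
          split_ifs with hj
          · exact sq_le_sq' (by linarith [(abs_le.1 (hf i j hj)).1]) ((abs_le.1 (hf i j hj)).2)
          · positivity
      _ = _ := by simp
  have := key (fun i j => g.1 i j) h1
  have := key (fun i j => (g⁻¹).1 j i) h2
  linarith

theorem InH.mul_DJ {h : SLn n} (hh : InH J h) : h.1 * DJ J = DJ J := by
  ext i j
  rw [DJ, Matrix.mul_diagonal, Matrix.diagonal_apply]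
  by_cases h1 : J j
  · rw [hh i j (Or.inr h1)]
    by_cases h2 : i = j
    · subst h2; simp [h1]
    · simp [h2]
  · by_cases h2 : i = j
    · subst h2; simp [h1]
    · simp [h1, h2]

theorem InH.DJ_mul {h : SLn n} (hh : InH J h) : DJ J * h.1 = DJ J := by
  ext i j
  rw [DJ, Matrix.diagonal_mul, Matrix.diagonal_apply]
  split_ifs with h1 h2 h2
  · subst h2; rw [hh i i (Or.inl h1)]; simp
  · rw [hh i j (Or.inl h1)]; simp [h2]
  · simp
  · simp

theorem inH_of {h : SLn n} (h1 : h.1 * DJ J = DJ J) (h2 : DJ J * h.1 = DJ J) : InH J h := by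
  intro i j hij
  rcases hij with hi | hj
  · have := congrFun (congrFun h2 i) j
    rw [DJ, Matrix.diagonal_mul, Matrix.diagonal_apply] at this
    simpa [hi] using this
  · have := congrFun (congrFun h1 i) j
    rw [DJ, Matrix.mul_diagonal, Matrix.diagonal_apply] at this
    by_cases hij : i = j
    · subst hij; simpa [hj] using this
    · simpa [hj, hij] using this

theorem InH.inv {h : SLn n} (hh : InH J h) : InH J h⁻¹ := by
  apply inH_of
  · conv_lhs => rw [← hh.mul_DJ, ← mul_assoc, sl_inv_mul, one_mul]
  · conv_lhs => rw [← hh.DJ_mul, mul_assoc, sl_mul_inv, mul_one]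

theorem DJ_transpose : (DJ J)ᵀ = DJ J := by simp [DJ]

theorem DJ_sq : DJ J * DJ J = DJ J := by
  rw [DJ, Matrix.diagonal_mul_diagonal]; congr 1; ext i; split_ifs <;> simp

theorem InH.nu_mul {h : SLn n} (hh : InH J h) (g : SLn n) : nu J (g * h) = nu J g := by
  have key : ∀ k : SLn n, InH J k → k.1 * DJ J * k.1ᵀ = DJ J ∧ k.1ᵀ * DJ J * k.1 = DJ J := by
    intro k hk
    have e1 := congrArg Matrix.transpose hk.mul_DJ
    have e2 := congrArg Matrix.transpose hk.DJ_mul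
    rw [Matrix.transpose_mul, DJ_transpose] at e1 e2
    rw [hk.mul_DJ, e1, e2, hk.DJ_mul]
    exact ⟨rfl, rfl⟩
  exact nu_mul_right g h (key h hh).1 (key _ hh.inv).2

end Geo1

section QRroot

open scoped Matrix.Norms.L2Operator MatrixOrder

theorem exists_psd_root {m : Type*} [Fintype m] [DecidableEq m] (A : Matrix m m ℝ)
    (hA : A.PosSemidef) : ∃ Q : Matrix m m ℝ, Q.PosSemidef ∧ Q * Q = A :=
  ⟨CFC.sqrt A, (CFC.sqrt_nonneg A).posSemidef, CFC.sqrt_mul_sqrt_self A hA.nonneg⟩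

end QRroot

section QR

variable {n : ℕ} {J : Fin n → Prop} [DecidablePred J]

theorem qr_lemma (i0 : Fin n) (hi0 : ¬ J i0) (B : ℝ) :
    ∃ R, 0 ≤ R ∧ ∀ g : SLn n, nu J g ≤ B → ∃ h : SLn n, InH J h ∧
      ∀ i j, |(g * h).1 i j| ≤ R ∧ |((g * h)⁻¹).1 i j| ≤ R := by
  set R1 : ℝ := Real.sqrt B + 1 with hR1
  have hR1' : 1 ≤ R1 := by have := Real.sqrt_nonneg B; linarith
  set M : ℝ := 1 + n * (R1 * R1) with hM
  have hM0 : 1 ≤ M := by have : 0 ≤ n * (R1 * R1) := by positivity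
                         linarith
  set R2 : ℝ := n * (R1 * M) + R1 with hR2
  obtain ⟨R3, hR30, hR3⟩ := bound_matBox (n := n) (fun A => A.det) (continuous_id.matrix_det) R2
  set R4 : ℝ := R1 * (1 + R3) with hR4
  have hR40 : 0 ≤ R4 := by positivity
  obtain ⟨R5, hR50, hR5⟩ := adjugate_bound (n := n) R4
  refine ⟨R4 + R5, by positivity, fun g hg => ?_⟩
  have sqb : ∀ x : ℝ, x ^ 2 ≤ B → |x| ≤ R1 := fun x hx =>
    (Real.abs_le_sqrt hx).trans (by linarith)
  have hcol : ∀ i j, J j → |g.1 i j| ≤ R1 := fun i j hj => sqb _ ((nu_sq_le_col g hj).trans hg)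
  have hrow : ∀ i j, J i → |(g⁻¹).1 i j| ≤ R1 := fun i j hj =>
    sqb _ ((nu_sq_le_row g hj).trans hg)
  set D := DJ J with hD
  have hDT : Dᵀ = D := DJ_transpose
  have hDD : D * D = D := DJ_sq
  set E : Matrix (Fin n) (Fin n) ℝ := 1 - D with hE
  have hET : Eᵀ = E := by rw [hE, Matrix.transpose_sub, hDT, Matrix.transpose_one]
  have hEE : E * E = E := by
    rw [hE]; simp only [mul_sub, sub_mul, mul_one, one_mul, hDD]; abel
  have hDE : D * E = 0 := by rw [hE, mul_sub, mul_one, hDD, sub_self]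
  have hED : E * D = 0 := by rw [hE, sub_mul, one_mul, hDD, sub_self]
  have hDdiag : D = Matrix.diagonal fun i => if J i then 1 else 0 := rfl
  have hEdiag : E = Matrix.diagonal fun i => if J i then 0 else 1 := by
    rw [hE, hDdiag, ← Matrix.diagonal_one, Matrix.diagonal_sub]
    congr 1; ext i; split_ifs <;> simp
  set G0 := E * g.1ᵀ * g.1 * E + D with hG0
  have hG0psd : G0.PosSemidef := by
    have h1 := Matrix.posSemidef_conjTranspose_mul_self (g.1 * E)
    have h2 := Matrix.posSemidef_conjTranspose_mul_self D
    have := h1.add h2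
    simp only [Matrix.conjTranspose_eq_transpose_of_trivial, Matrix.transpose_mul, hET, hDT,
      hDD] at this
    rw [hG0]
    simpa only [mul_assoc] using this
  obtain ⟨Q, hQpsd, hQQ⟩ := exists_psd_root G0 hG0psd
  have hQT : Qᵀ = Q := by
    have := hQpsd.1
    rwa [Matrix.IsHermitian, Matrix.conjTranspose_eq_transpose_of_trivial] at this
  have hG0D : G0 * D = D := by rw [hG0, add_mul, mul_assoc, hED, mul_zero, zero_add, hDD]
  -- Q acts as the identity on the `J`-coordinates
  have hQD : Q * D = D := by
    have h0 : (Q + 1) * ((Q - 1) * D) = 0 := by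
      have : (Q + 1) * ((Q - 1) * D) = Q * Q * D - D := by noncomm_ring
      rw [this, hQQ, hG0D, sub_self]
    have h1 : ((Q - 1) * D) = 0 := by
      have hpd : (Q + 1).PosDef := by
        rw [add_comm]; exact Matrix.PosDef.one.add_posSemidef hQpsd
      have hu := hpd.isUnit
      exact (hu.mul_right_eq_zero).1 h0
    rw [sub_mul, one_mul] at h1
    exact sub_eq_zero.1 h1
  have hDQ : D * Q = D := by
    have := congrArg Matrix.transpose hQD
    rwa [Matrix.transpose_mul, hQT, hDT] at this
  have hgu : g.1ᵀ * (g⁻¹).1ᵀ = 1 := by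
    rw [← Matrix.transpose_mul, sl_inv_mul, Matrix.transpose_one]
  have hQdet0 : Q.det ≠ 0 := by
    intro h0
    obtain ⟨v, hv, hQv⟩ := Matrix.exists_mulVec_eq_zero_iff.2 h0
    have hG0v : G0 *ᵥ v = 0 := by rw [← hQQ, ← Matrix.mulVec_mulVec, hQv, Matrix.mulVec_zero]
    have hDv : D *ᵥ v = 0 := by rw [← hDQ, ← Matrix.mulVec_mulVec, hQv, Matrix.mulVec_zero]
    have h2 : v ⬝ᵥ (G0 *ᵥ v) = (g.1 *ᵥ (E *ᵥ v)) ⬝ᵥ (g.1 *ᵥ (E *ᵥ v)) := by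
      rw [hG0, Matrix.add_mulVec, hDv, add_zero, ← Matrix.mulVec_mulVec, ← Matrix.mulVec_mulVec]
      rw [Matrix.dotProduct_mulVec, ← Matrix.mulVec_transpose, Matrix.transpose_mul, hET,
        Matrix.transpose_transpose, Matrix.mulVec_mulVec]
    rw [hG0v, dotProduct_zero] at h2
    have h3 := dotProduct_self_eq_zero.1 h2.symm
    have h4 : E *ᵥ v = 0 := by
      have := congrArg (fun x => (g⁻¹).1 *ᵥ x) h3
      simpa only [Matrix.mulVec_mulVec, ← mul_assoc, sl_inv_mul, one_mul, Matrix.mulVec_zero]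
        using this
    apply hv
    have : v = E *ᵥ v + D *ᵥ v := by
      rw [← Matrix.add_mulVec, hE, sub_add_cancel, Matrix.one_mulVec]
    rw [this, h4, hDv, add_zero]
  have hQu : IsUnit Q.det := hQdet0.isUnit
  have hQQi : Q * Q⁻¹ = 1 := Matrix.mul_nonsing_inv _ hQu
  have hQiQ : Q⁻¹ * Q = 1 := Matrix.nonsing_inv_mul _ hQu
  have hQiD : Q⁻¹ * D = D := by
    conv_lhs => rw [← hQD, ← mul_assoc, hQiQ, one_mul]
  have hDQi : D * Q⁻¹ = D := by
    conv_lhs => rw [← hDQ, mul_assoc, hQQi, mul_one]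
  have hQiT : Q⁻¹ᵀ = Q⁻¹ := by rw [Matrix.transpose_nonsing_inv, hQT]
  have hEQi : E * Q⁻¹ = Q⁻¹ * E := by rw [hE, sub_mul, mul_sub, hQiD, hDQi]; simp
  set g1 := g.1 * Q⁻¹ with hg1
  set k1 := Q * (g⁻¹).1 with hk1
  have hkg : k1 * g1 = 1 := by
    rw [hk1, hg1]
    calc _ = Q * ((g⁻¹).1 * g.1) * Q⁻¹ := by simp only [mul_assoc]
      _ = 1 := by rw [sl_inv_mul, mul_one, hQQi]
  have hgk : g1 * k1 = 1 := by
    rw [hk1, hg1]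
    calc _ = g.1 * (Q⁻¹ * Q) * (g⁻¹).1 := by simp only [mul_assoc]
      _ = 1 := by rw [hQiQ, mul_one, sl_mul_inv]
  have hgD : g1 * D = g.1 * D := by rw [hg1, mul_assoc, hQiD]
  have hDk : D * k1 = D * (g⁻¹).1 := by rw [hk1, ← mul_assoc, hDQ]
  have horth : E * g1ᵀ * g1 * E = E := by
    have : E * g1ᵀ * g1 * E = Q⁻¹ * (E * g.1ᵀ * g.1 * E) * Q⁻¹ := by
      rw [hg1, Matrix.transpose_mul, hQiT]
      calc _ = (E * Q⁻¹) * g.1ᵀ * g.1 * (Q⁻¹ * E) := by simp only [mul_assoc]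
        _ = (Q⁻¹ * E) * g.1ᵀ * g.1 * (E * Q⁻¹) := by rw [← hEQi]
        _ = _ := by simp only [mul_assoc]
    rw [this]
    have h5 : E * g.1ᵀ * g.1 * E = Q * Q - D := by rw [hQQ, hG0]; abel
    rw [h5, mul_sub, sub_mul, ← mul_assoc, hQiQ, one_mul, hQQi, hQiD, hDQi]
  -- columns of `g1`
  have hg1b : ∀ i j, |g1 i j| ≤ R1 := by
    intro i j
    by_cases hj : J j
    · have := congrFun (congrFun hgD i) j
      rw [hDdiag, Matrix.mul_diagonal, Matrix.mul_diagonal] at this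
      simp only [hj, if_true, mul_one] at this
      rw [this]; exact hcol i j hj
    · have := congrFun (congrFun horth j) j
      have h6 : E * g1ᵀ * g1 * E = E * (g1ᵀ * g1) * E := by simp only [mul_assoc]
      rw [h6, hEdiag, Matrix.mul_diagonal, Matrix.diagonal_mul, Matrix.diagonal_apply_eq] at this
      simp only [hj, if_false, mul_one, one_mul, Matrix.mul_apply, Matrix.transpose_apply] at this
      have h7 := Finset.single_le_sum (f := fun k => g1 k j * g1 k j)
        (fun k _ => mul_self_nonneg _) (Finset.mem_univ i)
      rw [this] at h7
      have : |g1 i j| ≤ 1 := by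
        rw [← sq_le_one_iff_abs_le_one, sq]; exact h7
      linarith
  have hk1b : ∀ i j, |k1 i j| ≤ R2 := by
    intro i j
    have hnn : 0 ≤ n * (R1 * M) := by positivity
    by_cases hi : J i
    · have := congrFun (congrFun hDk i) j
      rw [hDdiag, Matrix.diagonal_mul, Matrix.diagonal_mul] at this
      simp only [hi, if_true, one_mul] at this
      rw [this]
      have := hrow i j hi
      linarith
    · have h8 : E * k1 = E * (g1ᵀ * (1 - (g.1 * D) * (D * (g⁻¹).1))) := by
        rw [← hgD, ← hDk]
        calc E * k1 = E * g1ᵀ * g1 * E * k1 := by rw [horth]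
          _ = E * (g1ᵀ * (g1 * k1 - (g1 * (D * D)) * k1)) := by
              rw [hDD, hE]; noncomm_ring
          _ = _ := by rw [hgk]; simp only [mul_assoc]
      have := congrFun (congrFun h8 i) j
      rw [hEdiag, Matrix.diagonal_mul, Matrix.diagonal_mul] at this
      simp only [hi, if_false, one_mul] at this
      rw [this]
      have hb1 : ∀ i j, |(g.1 * D) i j| ≤ R1 := by
        intro i j
        rw [hDdiag, Matrix.mul_diagonal]
        split_ifs with hj
        · rw [mul_one]; exact hcol i j hj
        · simp; linarith
      have hb2 : ∀ i j, |(D * (g⁻¹).1) i j| ≤ R1 := by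
        intro i j
        rw [hDdiag, Matrix.diagonal_mul]
        split_ifs with hj
        · rw [one_mul]; exact hrow i j hj
        · simp; linarith
      have hb3 : ∀ i j, |(1 - (g.1 * D) * (D * (g⁻¹).1)) i j| ≤ M := by
        intro i j
        rw [Matrix.sub_apply]
        refine (abs_sub _ _).trans ?_
        have h9 := mul_bound hb1 hb2 i j
        have h10 : |(1 : Matrix (Fin n) (Fin n) ℝ) i j| ≤ 1 := by
          rw [Matrix.one_apply]; split_ifs <;> simp
        linarith
      have := mul_bound (A := g1ᵀ) (fun i j => hg1b j i) hb3 i j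
      linarith
  have hdet1 : k1.det = Q.det := by rw [hk1, Matrix.det_mul, (g⁻¹).2, mul_one]
  have hQdetb : |Q.det| ≤ R3 := by rw [← hdet1]; exact hR3 k1 hk1b
  set T : Matrix (Fin n) (Fin n) ℝ := Matrix.diagonal fun i => if i = i0 then Q.det else 1 with hT
  have hTdet : T.det = Q.det := by
    rw [hT, Matrix.det_diagonal, Finset.prod_ite_eq' ]; simp
  have hTD : T * D = D := by
    rw [hT, hDdiag, Matrix.diagonal_mul_diagonal]
    congr 1; ext i
    by_cases hi : J i
    · have : i ≠ i0 := fun e => hi0 (e ▸ hi)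
      simp [hi, this]
    · simp [hi]
  have hDT' : D * T = D := by
    rw [hT, hDdiag, Matrix.diagonal_mul_diagonal]
    congr 1; ext i
    by_cases hi : J i
    · have : i ≠ i0 := fun e => hi0 (e ▸ hi)
      simp [hi, this]
    · simp [hi]
  have hhdet : (Q⁻¹ * T).det = 1 := by
    rw [Matrix.det_mul, hTdet, Matrix.det_nonsing_inv, Ring.inverse_mul_cancel _ hQu]
  let h : SLn n := ⟨Q⁻¹ * T, hhdet⟩
  have hh1 : h.1 = Q⁻¹ * T := rfl
  refine ⟨h, inH_of ?_ ?_, ?_⟩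
  · rw [hh1, mul_assoc, hTD, hQiD]
  · rw [hh1, ← mul_assoc, hDQi, hDT']
  have hb : ∀ i j, |(g * h).1 i j| ≤ R4 := by
    intro i j
    rw [Matrix.SpecialLinearGroup.coe_mul, hh1, ← mul_assoc, ← hg1, hT, Matrix.mul_diagonal,
      abs_mul]
    refine mul_le_mul (hg1b i j) ?_ (abs_nonneg _) (by linarith)
    split_ifs
    · linarith
    · simp [hR30]
  intro i j
  have := hb i j
  have := hR5 (g * h) hb i j
  constructor <;> linarith

end QR

section SSsec

variable {n : ℕ} (J : Fin n → Prop) [DecidablePred J] (Γ : Subgroup (SLn n)) (B : ℝ)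

/-- The summand in the averaged form. -/
noncomputable def ssTerm (g : SLn n) (γ : Γ) : Matrix (Fin n) (Fin n) ℝ :=
  max 0 (B - nu J (γ.1 * g)) • (γ.1.1ᵀ * γ.1.1)

/-- The averaged quadratic form. -/
noncomputable def SS (g : SLn n) : Matrix (Fin n) (Fin n) ℝ := ∑ᶠ γ : Γ, ssTerm J Γ B g γ

/-- Properness in terms of `nu`. -/
def FinHyp : Prop := ∀ C : ℝ, {γ : Γ | ∃ g, nu J g ≤ C ∧ nu J (γ.1 * g) ≤ C}.Finite

variable {J Γ B}

theorem ssTerm_eq_zero {g : SLn n} {γ : Γ} (h : B ≤ nu J (γ.1 * g)) : ssTerm J Γ B g γ = 0 := by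
  rw [ssTerm, max_eq_left (by linarith), zero_smul]

theorem ssTerm_support (hf : FinHyp J Γ) (g : SLn n) :
    (Function.support (ssTerm J Γ B g)).Finite := by
  refine (hf (max B (nu J g))).subset fun γ hγ => ⟨g, le_max_right _ _, ?_⟩
  by_contra hlt
  push Not at hlt
  exact hγ (ssTerm_eq_zero ((le_max_left _ _).trans hlt.le))

theorem SS_continuous (hf : FinHyp J Γ) : Continuous (SS J Γ B) := by
  unfold SS
  apply continuous_finsum
  · intro γ
    unfold ssTerm
    have h1 : Continuous fun g : SLn n => max 0 (B - nu J (γ.1 * g)) := by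
      have := (nu_continuous (J := J)).comp (continuous_sl_mul_left γ.1)
      simp only [Function.comp_def] at this
      fun_prop
    exact h1.smul continuous_const
  · intro g0
    refine ⟨{g | nu J g < nu J g0 + 1}, ?_, ?_⟩
    · exact (isOpen_lt nu_continuous continuous_const).mem_nhds
        (by simp only [Set.mem_ofPred_eq]; linarith)
    · refine (hf (max B (nu J g0 + 1))).subset ?_
      rintro γ ⟨g, hg, hg2⟩
      refine ⟨g, le_trans (le_of_lt hg2) (le_max_right _ _), ?_⟩
      by_contra hlt
      push Not at hlt
      exact hg (ssTerm_eq_zero ((le_max_left _ _).trans hlt.le))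

theorem SS_right (g k : SLn n) (hk : ∀ x, nu J (x * k) = nu J x) :
    SS J Γ B (g * k) = SS J Γ B g := by
  unfold SS ssTerm
  simp only [← mul_assoc, hk]

theorem SS_equiv (hf : FinHyp J Γ) (g γ0 : SLn n) (h0 : γ0 ∈ Γ) :
    γ0.1ᵀ * SS J Γ B (γ0 * g) * γ0.1 = SS J Γ B g := by
  let φ : Matrix (Fin n) (Fin n) ℝ →+ Matrix (Fin n) (Fin n) ℝ :=
    { toFun := fun X => γ0.1ᵀ * X * γ0.1
      map_zero' := by simp
      map_add' := fun X Y => by rw [mul_add, add_mul] }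
  have h1 : γ0.1ᵀ * SS J Γ B (γ0 * g) * γ0.1 = φ (SS J Γ B (γ0 * g)) := rfl
  rw [h1, SS, AddMonoidHom.map_finsum φ (ssTerm_support hf _), SS]
  refine finsum_eq_of_bijective (fun γ : Γ => γ * ⟨γ0, h0⟩) (Group.mulRight_bijective _) ?_
  intro γ
  show γ0.1ᵀ * ssTerm J Γ B (γ0 * g) γ * γ0.1 = _
  unfold ssTerm
  simp only [Subgroup.coe_mul, Matrix.SpecialLinearGroup.coe_mul, Matrix.transpose_mul,
    mul_smul_comm, smul_mul_assoc, mul_assoc]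

theorem SS_symm (hf : FinHyp J Γ) (g : SLn n) : (SS J Γ B g)ᵀ = SS J Γ B g := by
  have h1 : (SS J Γ B g)ᵀ = Matrix.transposeAddEquiv (Fin n) (Fin n) ℝ (SS J Γ B g) := rfl
  rw [h1, SS]
  refine (AddMonoidHom.map_finsum (Matrix.transposeAddEquiv (Fin n) (Fin n) ℝ).toAddMonoidHom
    (ssTerm_support hf _)).trans ?_
  refine finsum_congr fun γ => ?_
  show (ssTerm J Γ B g γ)ᵀ = _
  rw [ssTerm, Matrix.transpose_smul, Matrix.transpose_mul, Matrix.transpose_transpose]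

theorem SS_lower (hf : FinHyp J Γ) (g γ0 : SLn n) (h0 : γ0 ∈ Γ) (hν : nu J (γ0 * g) ≤ B - 1)
    (x : Fin n → ℝ) :
    (γ0.1 *ᵥ x) ⬝ᵥ (γ0.1 *ᵥ x) ≤ x ⬝ᵥ (SS J Γ B g *ᵥ x) := by
  let φ : Matrix (Fin n) (Fin n) ℝ →+ ℝ :=
    { toFun := fun X => x ⬝ᵥ (X *ᵥ x)
      map_zero' := by simp
      map_add' := fun X Y => by rw [Matrix.add_mulVec, dotProduct_add] }
  have h1 : x ⬝ᵥ (SS J Γ B g *ᵥ x) = φ (SS J Γ B g) := rfl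
  have h2 : ∀ γ : Γ, φ (ssTerm J Γ B g γ) =
      max 0 (B - nu J (γ.1 * g)) * ((γ.1.1 *ᵥ x) ⬝ᵥ (γ.1.1 *ᵥ x)) := by
    intro γ
    show x ⬝ᵥ (ssTerm J Γ B g γ *ᵥ x) = _
    rw [ssTerm, Matrix.smul_mulVec, dotProduct_smul, smul_eq_mul, ← Matrix.mulVec_mulVec,
      Matrix.dotProduct_mulVec, Matrix.vecMul_transpose]
  rw [h1, SS, AddMonoidHom.map_finsum φ (ssTerm_support hf _)]
  have h3 := single_le_finsum (f := fun γ => φ (ssTerm J Γ B g γ)) (⟨γ0, h0⟩ : Γ)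
    ((ssTerm_support (B := B) hf g).subset fun γ hγ h => hγ (by simp only [h, map_zero]))
    (fun γ => by rw [h2]; exact mul_nonneg (le_max_left _ _) (dotProduct_self_star_nonneg _))
  refine le_trans ?_ h3
  rw [h2]
  have h4 : 1 ≤ max 0 (B - nu J (γ0 * g)) := le_max_of_le_right (by linarith)
  have h5 : 0 ≤ (γ0.1 *ᵥ x) ⬝ᵥ (γ0.1 *ᵥ x) := dotProduct_self_star_nonneg _
  show _ ≤ max 0 (B - nu J (γ0 * g)) * ((γ0.1 *ᵥ x) ⬝ᵥ (γ0.1 *ᵥ x))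
  nlinarith

end SSsec

section Geo3

variable {n : ℕ}

/-- Rank-one perturbation of the identity. -/
def tau (u v : Fin n → ℝ) : Matrix (Fin n) (Fin n) ℝ := 1 + Matrix.vecMulVec u v

theorem tau_mulVec (u v x : Fin n → ℝ) : tau u v *ᵥ x = x + (v ⬝ᵥ x) • u := by
  rw [tau, Matrix.add_mulVec, Matrix.one_mulVec, Matrix.vecMulVec_mulVec, op_smul_eq_smul]

theorem vecMul_tau (u v x : Fin n → ℝ) : x ᵥ* tau u v = x + (x ⬝ᵥ u) • v := by
  rw [tau, Matrix.vecMul_add, Matrix.vecMul_one, Matrix.vecMul_vecMulVec]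

theorem det_tau (u v : Fin n → ℝ) : (tau u v).det = 1 + v ⬝ᵥ u := by
  rw [tau, Matrix.vecMulVec_eq Unit, Matrix.det_one_add_replicateCol_mul_replicateRow]

/-- The unipotent element `1 + w e_pᵀ`. -/
noncomputable def nW (p : Fin n) (w : Fin n → ℝ) : SLn n :=
  ⟨tau (Function.update w p 0) (Pi.single p 1), by rw [det_tau]; simp⟩

theorem nW_coe {p : Fin n} {w : Fin n → ℝ} (hw : w p = 0) :
    (nW p w).1 = tau w (Pi.single p 1) := by
  have : Function.update w p 0 = w := by rw [← hw]; exact Function.update_eq_self p w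
  show tau (Function.update w p 0) (Pi.single p 1) = _
  rw [this]

theorem nW_mulVec {p : Fin n} {w : Fin n → ℝ} (hw : w p = 0) (x : Fin n → ℝ) :
    (nW p w).1 *ᵥ x = x + x p • w := by
  rw [nW_coe hw, tau_mulVec, single_one_dotProduct]

theorem sl_ext_mulVec {a b : SLn n} (h : ∀ x, a.1 *ᵥ x = b.1 *ᵥ x) : a = b := by
  apply Subtype.ext
  exact Matrix.mulVec_injective (funext h)

theorem sl_mulVec_mulVec (a b : SLn n) (x : Fin n → ℝ) :
    (a * b).1 *ᵥ x = a.1 *ᵥ (b.1 *ᵥ x) := by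
  rw [Matrix.SpecialLinearGroup.coe_mul, Matrix.mulVec_mulVec]

theorem nW_mul {p : Fin n} {w w' : Fin n → ℝ} (hw : w p = 0) (hw' : w' p = 0) :
    nW p w * nW p w' = nW p (w + w') := by
  apply sl_ext_mulVec
  intro x
  rw [sl_mulVec_mulVec, nW_mulVec hw, nW_mulVec hw', nW_mulVec (by simp [hw, hw'])]
  simp only [Pi.add_apply, Pi.smul_apply, hw', smul_zero, add_zero, smul_add]
  abel

theorem nW_zero {p : Fin n} : nW p (0 : Fin n → ℝ) = 1 := by
  apply sl_ext_mulVec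
  intro x
  rw [nW_mulVec (by simp)]
  simp

theorem nW_inv {p : Fin n} {w : Fin n → ℝ} (hw : w p = 0) : (nW p w)⁻¹ = nW p (-w) := by
  rw [inv_eq_iff_mul_eq_one, nW_mul hw (by simp [hw]), add_neg_cancel, nW_zero]

variable {J : Fin n → Prop} [DecidablePred J] {p : Fin n}

theorem InH.mulVec_apply {h : SLn n} (hh : InH J h) (x : Fin n → ℝ) {i : Fin n} (hi : J i) :
    (h.1 *ᵥ x) i = x i := by
  have : ∀ j, h.1 i j = if i = j then 1 else 0 := fun j => hh i j (Or.inl hi)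
  simp only [Matrix.mulVec, dotProduct, this]
  simp

theorem InH.mulVec_single {h : SLn n} (hh : InH J h) {i : Fin n} (hi : J i) :
    h.1 *ᵥ Pi.single i 1 = Pi.single i 1 := by
  ext j
  rw [Matrix.mulVec_single_one, Matrix.col_apply, hh j i (Or.inr hi), Pi.single_apply]

theorem InH.mul_nW {h : SLn n} (hh : InH J h) (hp : J p) {w : Fin n → ℝ}
    (hw : ∀ i, J i → w i = 0) : h * nW p w = nW p (h.1 *ᵥ w) * h := by
  apply sl_ext_mulVec
  intro x
  have h2 : (h.1 *ᵥ w) p = 0 := by rw [hh.mulVec_apply _ hp, hw p hp]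
  rw [sl_mulVec_mulVec, sl_mulVec_mulVec, nW_mulVec (hw p hp), nW_mulVec h2, Matrix.mulVec_add,
    Matrix.mulVec_smul, hh.mulVec_apply _ hp]

theorem exists_ghat (hp : J p) (i0 : Fin n) (hi0 : ¬ J i0) (u η : Fin n → ℝ)
    (hu : ∀ i, J i → i ≠ p → u i = 0) (hη : ∀ i, J i → i ≠ p → η i = 0) (hηu : η ⬝ᵥ u = 1) :
    ∃ X : SLn n, X.1 *ᵥ Pi.single p 1 = u ∧
      (∀ j, J j → j ≠ p → X.1 *ᵥ Pi.single j 1 = Pi.single j 1) ∧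
      Pi.single p 1 ᵥ* (X⁻¹).1 = η ∧
      (∀ j, J j → j ≠ p → Pi.single j 1 ᵥ* (X⁻¹).1 = Pi.single j 1) := by
  classical
  set α := u p with hα
  set z : Fin n → ℝ := u - Pi.single p α with hz
  have hzp : z p = 0 := by simp [hz, hα]
  have hzJ : ∀ i, J i → z i = 0 := by
    intro i hi
    by_cases hip : i = p
    · rw [hip, hzp]
    · simp [hz, hu i hi hip, hip]
  have huz : u = z + Pi.single p α := by rw [hz]; abel
  obtain ⟨c, hc⟩ : ∃ c : ℝ, α + c * (z ⬝ᵥ z) ≠ 0 := by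
    by_cases h0 : α = 0
    · refine ⟨1, ?_⟩
      rw [h0, zero_add, one_mul]
      intro hzz
      have hz0 := dotProduct_self_eq_zero.1 hzz
      rw [huz, hz0, h0] at hηu
      simp at hηu
    · exact ⟨0, by simpa using h0⟩
  set v : Fin n → ℝ := Pi.single p 1 + c • z with hv
  have hvp : v p = 1 := by simp [hv, hzp]
  have hvJ : ∀ j, J j → j ≠ p → v j = 0 := by
    intro j hj hjp; simp [hv, hzJ j hj, hjp]
  set t1 := tau (u - Pi.single p 1) v with ht1
  have hd1 : t1.det = α + c * (z ⬝ᵥ z) := by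
    rw [ht1, det_tau, hv, huz]
    simp [add_dotProduct, dotProduct_add, dotProduct_sub, hzp]
    ring
  set d := α + c * (z ⬝ᵥ z) with hd
  set Δ : Matrix (Fin n) (Fin n) ℝ := Matrix.diagonal fun i => if i = i0 then d⁻¹ else 1 with hΔ
  have hΔdet : Δ.det = d⁻¹ := by
    rw [hΔ, Matrix.det_diagonal, Finset.prod_ite_eq']; simp
  have hΔJ : ∀ j, J j → Δ *ᵥ Pi.single j 1 = Pi.single j 1 := by
    intro j hj
    have : j ≠ i0 := fun e => hi0 (e ▸ hj)
    ext i
    rw [hΔ, Matrix.mulVec_diagonal]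
    by_cases hij : i = j
    · subst hij; simp [this]
    · simp [hij]
  have hΔJ' : ∀ j, J j → Pi.single j 1 ᵥ* Δ = Pi.single j 1 := by
    intro j hj
    have := hΔJ j hj
    rw [← Matrix.vecMul_transpose] at this
    rwa [hΔ, Matrix.diagonal_transpose] at this
  let X1 : SLn n := ⟨t1 * Δ, by rw [Matrix.det_mul, hd1, hΔdet, mul_inv_cancel₀ hc]⟩
  have hX1 : X1.1 = t1 * Δ := rfl
  have hX1p : X1.1 *ᵥ Pi.single p 1 = u := by
    rw [hX1, ← Matrix.mulVec_mulVec, hΔJ p hp, ht1, tau_mulVec, dotProduct_single_one, hvp]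
    simp
  have hX1j : ∀ j, J j → j ≠ p → X1.1 *ᵥ Pi.single j 1 = Pi.single j 1 := by
    intro j hj hjp
    rw [hX1, ← Matrix.mulVec_mulVec, hΔJ j hj, ht1, tau_mulVec, dotProduct_single_one,
      hvJ j hj hjp]
    simp
  have hX1r : ∀ j, J j → j ≠ p → Pi.single j 1 ᵥ* X1.1 = Pi.single j 1 := by
    intro j hj hjp
    have : (u - Pi.single p 1 : Fin n → ℝ) j = 0 := by simp [hu j hj hjp, hjp]
    rw [hX1, ← Matrix.vecMul_vecMul, ht1, vecMul_tau, single_one_dotProduct, this, zero_smul,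
      add_zero, hΔJ' j hj]
  set f : Fin n → ℝ := Pi.single p 1 ᵥ* (X1⁻¹).1 with hf
  have hfX : f ᵥ* X1.1 = Pi.single p 1 := by
    rw [hf, Matrix.vecMul_vecMul, sl_inv_mul, Matrix.vecMul_one]
  have hfu : f ⬝ᵥ u = 1 := by
    rw [← hX1p, Matrix.dotProduct_mulVec, hfX]; simp
  have hfj : ∀ j, J j → j ≠ p → f j = 0 := by
    intro j hj hjp
    rw [← dotProduct_single_one f j, ← hX1j j hj hjp, Matrix.dotProduct_mulVec, hfX]
    simp [hjp.symm]
  let X : SLn n := ⟨tau u (f - η) * X1.1, by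
    rw [Matrix.det_mul, det_tau, X1.2, sub_dotProduct, hfu, hηu]; simp⟩
  have hX : X.1 = tau u (f - η) * X1.1 := rfl
  have hrow : ∀ y z : Fin n → ℝ, z ᵥ* X.1 = y → y ᵥ* (X⁻¹).1 = z := by
    intro y z h
    rw [← h, Matrix.vecMul_vecMul, sl_mul_inv, Matrix.vecMul_one]
  refine ⟨X, ?_, ?_, ?_, ?_⟩
  · rw [hX, ← Matrix.mulVec_mulVec, hX1p, tau_mulVec, sub_dotProduct, hfu, hηu]; simp
  · intro j hj hjp
    rw [hX, ← Matrix.mulVec_mulVec, hX1j j hj hjp, tau_mulVec, dotProduct_single_one]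
    simp [hfj j hj hjp, hη j hj hjp]
  · apply hrow
    rw [hX, ← Matrix.vecMul_vecMul, vecMul_tau, hηu, one_smul, add_sub_cancel, hfX]
  · intro j hj hjp
    apply hrow
    rw [hX, ← Matrix.vecMul_vecMul, vecMul_tau, single_one_dotProduct, hu j hj hjp, zero_smul,
      add_zero, hX1r j hj hjp]

theorem nu_ghat_le {X x : SLn n} {u η : Fin n → ℝ} {C : ℝ}
    (h1 : X.1 *ᵥ Pi.single p 1 = u)
    (h2 : ∀ j, J j → j ≠ p → X.1 *ᵥ Pi.single j 1 = Pi.single j 1)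
    (h3 : Pi.single p 1 ᵥ* (X⁻¹).1 = η)
    (h4 : ∀ j, J j → j ≠ p → Pi.single j 1 ᵥ* (X⁻¹).1 = Pi.single j 1)
    (b1 : ∀ j, J j → j ≠ p → ∀ i, |x.1 i j| ≤ C) (b2 : ∀ i, |(x.1 *ᵥ u) i| ≤ C)
    (b3 : ∀ j, J j → j ≠ p → ∀ i, |(x⁻¹).1 j i| ≤ C) (b4 : ∀ i, |(η ᵥ* (x⁻¹).1) i| ≤ C) :
    nu J (x * X) ≤ 2 * (n * (n * C ^ 2)) := by
  apply nu_le
  · intro i j hj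
    have : (x * X).1 i j = (x.1 *ᵥ (X.1 *ᵥ Pi.single j 1)) i := by
      rw [← sl_mulVec_mulVec, Matrix.mulVec_single_one]; rfl
    rw [this]
    by_cases hjp : j = p
    · rw [hjp, h1]; exact b2 i
    · rw [h2 j hj hjp, Matrix.mulVec_single_one]; exact b1 j hj hjp i
  · intro i j hj
    have : ((x * X)⁻¹).1 j i = ((Pi.single j 1 ᵥ* (X⁻¹).1) ᵥ* (x⁻¹).1) i := by
      rw [Matrix.vecMul_vecMul, Matrix.single_one_vecMul, _root_.mul_inv_rev]; rfl
    rw [this]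
    by_cases hjp : j = p
    · rw [hjp, h3]; exact b4 i
    · rw [h4 j hj hjp, Matrix.single_one_vecMul]; exact b3 j hj hjp i

end Geo3

section Geo4

variable {n : ℕ} (J : Fin n → Prop) [DecidablePred J] (Γ : Subgroup (SLn n)) (B : ℝ)

/-- The averaged form, as a bilinear form. -/
noncomputable def bb (g : SLn n) (x y : Fin n → ℝ) : ℝ := x ⬝ᵥ (SS J Γ B g *ᵥ y)

/-- Cocompactness in terms of `nu`. -/
def CocHyp : Prop := ∀ g : SLn n, ∃ γ ∈ Γ, nu J (γ * g) ≤ B - 1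

/-- Vectors supported on the complement of `J`. -/
def InW (w : Fin n → ℝ) : Prop := ∀ i, J i → w i = 0

/-- Vectors supported on the complement of `J` together with `p`. -/
def InY (p : Fin n) (y : Fin n → ℝ) : Prop := ∀ i, J i → i ≠ p → y i = 0

variable {J Γ B}

theorem bb_equiv (hf : FinHyp J Γ) {γ : SLn n} (hγ : γ ∈ Γ) (g : SLn n) (x y : Fin n → ℝ) :
    bb J Γ B (γ * g) (γ.1 *ᵥ x) (γ.1 *ᵥ y) = bb J Γ B g x y := by
  unfold bb
  rw [← SS_equiv hf g γ hγ, Matrix.mulVec_mulVec, ← Matrix.vecMul_transpose,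
    ← Matrix.dotProduct_mulVec, Matrix.mulVec_mulVec, ← Matrix.mul_assoc]

theorem bb_right {h : SLn n} (hh : InH J h) (g : SLn n) : bb J Γ B (g * h) = bb J Γ B g := by
  funext x y
  unfold bb
  rw [SS_right g h (fun x => hh.nu_mul x)]

theorem bb_smul_left (g : SLn n) (c : ℝ) (x y : Fin n → ℝ) :
    bb J Γ B g (c • x) y = c * bb J Γ B g x y := by
  unfold bb; rw [smul_dotProduct, smul_eq_mul]

theorem bb_smul_right (g : SLn n) (c : ℝ) (x y : Fin n → ℝ) :
    bb J Γ B g x (c • y) = c * bb J Γ B g x y := by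
  unfold bb; rw [Matrix.mulVec_smul, dotProduct_smul, smul_eq_mul]

theorem bb_lower (hf : FinHyp J Γ) {c : SLn n} (hc : nu J c ≤ B - 1) (x : Fin n → ℝ) :
    x ⬝ᵥ x ≤ bb J Γ B c x x := by
  have := SS_lower hf c 1 Γ.one_mem (by simpa using hc) x
  simpa [bb] using this

theorem entry_sq_le (x : Fin n → ℝ) (i : Fin n) : (x i) ^ 2 ≤ x ⬝ᵥ x := by
  rw [pow_two]
  exact Finset.single_le_sum (f := fun i => x i * x i) (fun j _ => mul_self_nonneg _)
    (Finset.mem_univ i)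

theorem abs_le_of_dot_le {x : Fin n → ℝ} {a : ℝ} (h : x ⬝ᵥ x ≤ a ^ 2) (ha : 0 ≤ a) (i : Fin n) :
    |x i| ≤ a := abs_le_of_sq_le_sq ((entry_sq_le x i).trans h) ha

theorem exists_rep (i0 : Fin n) (hi0 : ¬ J i0) (hcoc : CocHyp J Γ B) :
    ∃ R : ℝ, 0 ≤ R ∧ ∀ g : SLn n, ∃ γ ∈ Γ, ∃ h, InH J h ∧ nu J (γ * g * h) ≤ B - 1 ∧
      (∀ i j, |(γ * g * h).1 i j| ≤ R) ∧ ∀ i j, |((γ * g * h)⁻¹).1 i j| ≤ R := by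
  obtain ⟨R, hR, h⟩ := qr_lemma (J := J) i0 hi0 (B - 1)
  refine ⟨R, hR, fun g => ?_⟩
  obtain ⟨γ, hγ, hν⟩ := hcoc g
  obtain ⟨k, hk, hb⟩ := h _ hν
  refine ⟨γ, hγ, k, hk, ?_, fun i j => (hb i j).1, fun i j => (hb i j).2⟩
  rw [hk.nu_mul]; exact hν

theorem exists_kappa (hf : FinHyp J Γ) (R : ℝ) :
    ∃ κ : ℝ, 0 ≤ κ ∧ ∀ c : SLn n, (∀ i j, |c.1 i j| ≤ R) → ∀ i j, |SS J Γ B c i j| ≤ κ :=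
  bound_slBox _ (SS_continuous hf) R

variable {p : Fin n}

theorem finite_inv_bound {T : Set Γ} (hT : T.Finite) :
    ∃ D : ℝ, 0 ≤ D ∧ ∀ γ ∈ T, ∀ i j, |((γ.1)⁻¹).1 i j| ≤ D := by
  classical
  refine ⟨∑ γ ∈ hT.toFinset, ∑ i, ∑ j, |((γ.1)⁻¹).1 i j|, by positivity, ?_⟩
  intro γ hγ i j
  have h1 : |((γ.1)⁻¹).1 i j| ≤ ∑ j, |((γ.1)⁻¹).1 i j| :=
    Finset.single_le_sum (f := fun j => |((γ.1)⁻¹).1 i j|) (fun _ _ => abs_nonneg _)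
      (Finset.mem_univ j)
  have h2 : ∑ j, |((γ.1)⁻¹).1 i j| ≤ ∑ i, ∑ j, |((γ.1)⁻¹).1 i j| :=
    Finset.single_le_sum (f := fun i => ∑ j, |((γ.1)⁻¹).1 i j|)
      (fun _ _ => Finset.sum_nonneg fun _ _ => abs_nonneg _) (Finset.mem_univ i)
  have h3 : ∑ i, ∑ j, |((γ.1)⁻¹).1 i j| ≤
      ∑ γ ∈ hT.toFinset, ∑ i, ∑ j, |((γ.1)⁻¹).1 i j| :=
    Finset.single_le_sum (f := fun γ : Γ => ∑ i, ∑ j, |((γ.1)⁻¹).1 i j|)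
      (fun _ _ => Finset.sum_nonneg fun _ _ => Finset.sum_nonneg fun _ _ => abs_nonneg _)
      (hT.mem_toFinset.2 hγ)
  exact h1.trans (h2.trans h3)

/-- The normalised form of the key boundedness statement. -/
theorem lemmaA1 (hf : FinHyp J Γ) (hcoc : CocHyp J Γ B) (hp : J p) (i0 : Fin n) (hi0 : ¬ J i0)
    (R : ℝ) (hR : 0 ≤ R) :
    ∃ ρ : ℝ, ∀ (c : SLn n) (w u : Fin n → ℝ), nu J c ≤ B - 1 → (∀ i j, |c.1 i j| ≤ R) →
      (∀ i j, |(c⁻¹).1 i j| ≤ R) → InW J w → InY J p u →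
      bb J Γ B c (c.1 *ᵥ u) (c.1 *ᵥ u) = 1 →
      (∀ y, InY J p y → bb J Γ B (c * nW p w) (c.1 *ᵥ y) (c.1 *ᵥ u) =
        bb J Γ B c (c.1 *ᵥ y) (c.1 *ᵥ u)) →
      bb J Γ B c (c.1 *ᵥ w) (c.1 *ᵥ w) ≤ ρ := by
  obtain ⟨R', hR', hrep⟩ := exists_rep (J := J) (Γ := Γ) i0 hi0 hcoc
  set Q := max R R' with hQ
  have hQ0 : 0 ≤ Q := hR.trans (le_max_left _ _)
  obtain ⟨κ, hκ, hκb⟩ := exists_kappa (B := B) hf Q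
  set E : ℝ := n * ((n * ((n * (κ * 1)) * Q)) * Q) with hE
  have hE0 : 0 ≤ E := by positivity
  set C : ℝ := Q + 1 + E with hC
  obtain ⟨D, hD, hDb⟩ := finite_inv_bound (hf (2 * (n * (n * C ^ 2))))
  set b : ℝ := n * (D * Q) + Q with hb
  refine ⟨n * (b * (n * (κ * b))), ?_⟩
  intro c w u hcν hcR hcR' hw hu h1 hdeg
  have hcQ : ∀ i j, |c.1 i j| ≤ Q := fun i j => (hcR i j).trans (le_max_left _ _)
  have hcQ' : ∀ i j, |(c⁻¹).1 i j| ≤ Q := fun i j => (hcR' i j).trans (le_max_left _ _)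
  obtain ⟨γ, hγ, h, hh, hν2, hc2, hc2'⟩ := hrep (c * nW p w)
  set m := nW p w * h with hm
  set c2 := γ * (c * nW p w) * h with hc2def
  have hc2m : c2 = (γ * c) * m := by rw [hc2def, hm]; group
  have hc2Q : ∀ i j, |c2.1 i j| ≤ Q := fun i j => (hc2 i j).trans (le_max_right _ _)
  have hc2Q' : ∀ i j, |(c2⁻¹).1 i j| ≤ Q := fun i j => (hc2' i j).trans (le_max_right _ _)
  have hwp : w p = 0 := hw p hp
  have hmv : ∀ x, m.1 *ᵥ x = h.1 *ᵥ x + x p • w := by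
    intro x
    rw [hm, sl_mulVec_mulVec, nW_mulVec hwp, hh.mulVec_apply _ hp]
  have hmY : ∀ y, InY J p y → InY J p (m.1 *ᵥ y) := by
    intro y hy i hi hip
    rw [hmv, Pi.add_apply, hh.mulVec_apply _ hi, hy i hi hip, Pi.smul_apply, hw i hi]; simp
  have hmj : ∀ j, J j → j ≠ p → m.1 *ᵥ Pi.single j 1 = Pi.single j 1 := by
    intro j hj hjp
    rw [hmv, hh.mulVec_single hj]; simp [hjp.symm]
  have hmp : m.1 *ᵥ Pi.single p 1 = Pi.single p 1 + w := by
    rw [hmv, hh.mulVec_single hp]; simp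
  have hmr : ∀ j, J j → j ≠ p → Pi.single j 1 ᵥ* m.1 = Pi.single j 1 := by
    intro j hj hjp
    ext i
    have : (Pi.single j 1 ᵥ* m.1) i = (m.1 *ᵥ Pi.single i 1) j := by
      rw [Matrix.single_one_vecMul, Matrix.mulVec_single_one]; rfl
    rw [this, hmv, Pi.add_apply, hh.mulVec_apply _ hj, Pi.smul_apply, hw j hj]
    simp [Pi.single_apply, eq_comm]
  -- the transported vector
  set x := γ * c with hx
  have key : ∀ y, InY J p y → bb J Γ B c2 (x.1 *ᵥ y) (x.1 *ᵥ u) =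
      bb J Γ B c (c.1 *ᵥ y) (c.1 *ᵥ u) := by
    intro y hy
    rw [← hdeg y hy, hc2def, bb_right hh, hx, sl_mulVec_mulVec, sl_mulVec_mulVec, bb_equiv hf hγ]
  clear_value x
  have hcu : ∀ i, |(c.1 *ᵥ u) i| ≤ 1 :=
    abs_le_of_dot_le ((bb_lower hf hcν _).trans (by rw [h1]; norm_num)) zero_le_one
  have hxu : ∀ i, |(x.1 *ᵥ u) i| ≤ 1 :=
    abs_le_of_dot_le ((bb_lower hf hν2 _).trans (by rw [key u hu, h1]; norm_num)) zero_le_one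
  -- covectors
  set η0 : Fin n → ℝ := (SS J Γ B c *ᵥ (c.1 *ᵥ u)) ᵥ* c.1 with hη0
  set η : Fin n → ℝ := fun i => if J i ∧ i ≠ p then 0 else η0 i with hη
  set ξ0 : Fin n → ℝ := (SS J Γ B c2 *ᵥ (x.1 *ᵥ u)) ᵥ* c2.1 with hξ0
  set ξ : Fin n → ℝ := fun i => if J i ∧ i ≠ p then 0 else ξ0 i with hξ
  have hηY : InY J p η := fun i hi hip => by simp [hη, hi, hip]
  have hetay : ∀ y, η0 ⬝ᵥ y = bb J Γ B c (c.1 *ᵥ y) (c.1 *ᵥ u) := by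
    intro y
    rw [hη0, ← Matrix.dotProduct_mulVec, bb, dotProduct_comm]
  have hxiy : ∀ y, ξ0 ⬝ᵥ y = bb J Γ B c2 (c2.1 *ᵥ y) (x.1 *ᵥ u) := by
    intro y
    rw [hξ0, ← Matrix.dotProduct_mulVec, bb, dotProduct_comm]
  have hηy : ∀ y, InY J p y → η ⬝ᵥ y = η0 ⬝ᵥ y := by
    intro y hy
    unfold dotProduct
    refine Finset.sum_congr rfl fun i _ => ?_
    by_cases hi : J i ∧ i ≠ p
    · rw [hy i hi.1 hi.2]; simp
    · simp [hη, hi]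
  have hηu : η ⬝ᵥ u = 1 := by rw [hηy u hu, hetay, h1]
  have hηm : η ᵥ* m.1 = ξ := by
    ext i
    rw [← dotProduct_single_one (η ᵥ* m.1) i, ← Matrix.dotProduct_mulVec]
    by_cases hi : J i ∧ i ≠ p
    · rw [hmj i hi.1 hi.2, dotProduct_single_one]; simp [hη, hξ, hi]
    · have hY : InY J p (Pi.single i 1) := by
        intro j hj hjp
        have : j ≠ i := fun e => hi ⟨e ▸ hj, e ▸ hjp⟩
        simp [this]
      rw [hηy _ (hmY _ hY), hetay, ← key _ (hmY _ hY)]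
      have : x.1 *ᵥ (m.1 *ᵥ Pi.single i 1) = c2.1 *ᵥ Pi.single i 1 := by
        rw [hc2m]; exact (sl_mulVec_mulVec x m _).symm
      rw [this, ← hxiy, dotProduct_single_one]
      simp [hξ, hi]
  have hηb : ∀ i, |η i| ≤ n * ((n * (κ * 1)) * Q) := by
    intro i
    by_cases hi : J i ∧ i ≠ p
    · have : η i = 0 := by simp [hη, hi]
      rw [this, abs_zero]; positivity
    · have : η i = η0 i := by simp [hη, hi]
      rw [this]
      exact vecMul_bound hcQ (fun j => mulVec_bound (hκb c hcQ) hcu j) i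
  have hξb : ∀ i, |ξ i| ≤ n * ((n * (κ * 1)) * Q) := by
    intro i
    by_cases hi : J i ∧ i ≠ p
    · have : ξ i = 0 := by simp [hξ, hi]
      rw [this, abs_zero]; positivity
    · have : ξ i = ξ0 i := by simp [hξ, hi]
      rw [this]
      exact vecMul_bound hc2Q (fun j => mulVec_bound (hκb c2 hc2Q) hxu j) i
  have hxinv : x⁻¹ = m * c2⁻¹ := by rw [hc2m]; group
  have hxm : x = c2 * m⁻¹ := by rw [hc2m]; group
  have hηx : η ᵥ* (x⁻¹).1 = ξ ᵥ* (c2⁻¹).1 := by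
    rw [hxinv, Matrix.SpecialLinearGroup.coe_mul, ← Matrix.vecMul_vecMul, hηm]
  obtain ⟨X, X1, X2, X3, X4⟩ := exists_ghat hp i0 hi0 u η hu hηY hηu
  have hQC : Q ≤ C := by rw [hC]; linarith
  have h1C : 1 ≤ C := by rw [hC]; linarith
  have hEC : E ≤ C := by rw [hC]; linarith
  have n1 : nu J (c * X) ≤ 2 * (n * (n * C ^ 2)) := by
    refine nu_ghat_le X1 X2 X3 X4 (fun j _ _ i => (hcQ i j).trans hQC)
      (fun i => (hcu i).trans h1C) (fun j _ _ i => (hcQ' j i).trans hQC) (fun i => ?_)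
    exact (vecMul_bound hcQ' hηb i).trans hEC
  have n2 : nu J (x * X) ≤ 2 * (n * (n * C ^ 2)) := by
    refine nu_ghat_le X1 X2 X3 X4 (fun j hj hjp i => ?_)
      (fun i => (hxu i).trans h1C) (fun j hj hjp i => ?_) (fun i => ?_)
    · have : x.1 i j = c2.1 i j := by
        have e : x.1 *ᵥ Pi.single j 1 = c2.1 *ᵥ Pi.single j 1 := by
          rw [hc2m, sl_mulVec_mulVec, hmj j hj hjp]
        rw [Matrix.mulVec_single_one, Matrix.mulVec_single_one] at e
        exact congrFun e i
      rw [this]; exact (hc2Q i j).trans hQC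
    · have : (x⁻¹).1 j i = (c2⁻¹).1 j i := by
        have e : Pi.single j 1 ᵥ* (x⁻¹).1 = Pi.single j 1 ᵥ* (c2⁻¹).1 := by
          rw [hxinv, Matrix.SpecialLinearGroup.coe_mul, ← Matrix.vecMul_vecMul, hmr j hj hjp]
        rw [Matrix.single_one_vecMul, Matrix.single_one_vecMul] at e
        exact congrFun e i
      rw [this]; exact (hc2Q' j i).trans hQC
    · rw [hηx]
      exact (vecMul_bound hc2Q' hξb i).trans hEC
  have hγD := hDb ⟨γ, hγ⟩ ⟨c * X, n1, by
    show nu J (γ * (c * X)) ≤ _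
    rw [← mul_assoc, ← hx]; exact n2⟩
  have hcw : c.1 *ᵥ w = (γ⁻¹).1 *ᵥ (c2.1 *ᵥ Pi.single p 1) - c.1 *ᵥ Pi.single p 1 := by
    rw [← sl_mulVec_mulVec]
    have : γ⁻¹ * c2 = c * m := by rw [hc2m, hx]; group
    rw [this, sl_mulVec_mulVec, hmp, Matrix.mulVec_add]; abel
  have hcwb : ∀ i, |(c.1 *ᵥ w) i| ≤ b := by
    intro i
    rw [hcw, Pi.sub_apply]
    refine (abs_sub _ _).trans (add_le_add ?_ ?_)
    · refine mulVec_bound hγD (fun j => ?_) i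
      rw [Matrix.mulVec_single_one]; exact hc2Q j p
    · rw [Matrix.mulVec_single_one]; exact hcQ i p
  exact quad_bound (hκb c hcQ) hcwb

theorem lemmaA (hf : FinHyp J Γ) (hcoc : CocHyp J Γ B) (hp : J p) (i0 : Fin n) (hi0 : ¬ J i0) :
    ∃ ρ : ℝ, ∀ (g : SLn n) (w u : Fin n → ℝ), InW J w → InY J p u → u ≠ 0 →
      (∀ y, InY J p y → bb J Γ B (g * nW p w) (g.1 *ᵥ y) (g.1 *ᵥ u) =
        bb J Γ B g (g.1 *ᵥ y) (g.1 *ᵥ u)) →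
      bb J Γ B g (g.1 *ᵥ w) (g.1 *ᵥ w) ≤ ρ := by
  obtain ⟨R, hR, hrep⟩ := exists_rep (J := J) (Γ := Γ) i0 hi0 hcoc
  obtain ⟨ρ, hρ⟩ := lemmaA1 hf hcoc hp i0 hi0 R hR
  refine ⟨ρ, fun g w u hw hu hu0 hdeg => ?_⟩
  obtain ⟨γ, hγ, h, hh, hν, hc, hc'⟩ := hrep g
  set c := γ * g * h with hcdef
  have hinv : ∀ x, h.1 *ᵥ ((h⁻¹).1 *ᵥ x) = x := by
    intro x; rw [Matrix.mulVec_mulVec, sl_mul_inv, Matrix.one_mulVec]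
  have hinv' : ∀ x, (h⁻¹).1 *ᵥ (h.1 *ᵥ x) = x := by
    intro x; rw [Matrix.mulVec_mulVec, sl_inv_mul, Matrix.one_mulVec]
  have hcx : ∀ x, c.1 *ᵥ ((h⁻¹).1 *ᵥ x) = γ.1 *ᵥ (g.1 *ᵥ x) := by
    intro x; rw [hcdef, sl_mulVec_mulVec, sl_mulVec_mulVec, hinv]
  have hbc : ∀ x y, bb J Γ B c (c.1 *ᵥ ((h⁻¹).1 *ᵥ x)) (c.1 *ᵥ ((h⁻¹).1 *ᵥ y)) =
      bb J Γ B g (g.1 *ᵥ x) (g.1 *ᵥ y) := by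
    intro x y
    rw [hcx, hcx, hcdef, bb_right hh, bb_equiv hf hγ]
  have hw' : InW J ((h⁻¹).1 *ᵥ w) := fun i hi => by rw [hh.inv.mulVec_apply _ hi, hw i hi]
  have hu' : InY J p ((h⁻¹).1 *ᵥ u) := fun i hi hip => by
    rw [hh.inv.mulVec_apply _ hi, hu i hi hip]
  have hcn : c * nW p ((h⁻¹).1 *ᵥ w) = γ * (g * nW p w) * h := by
    rw [hcdef, mul_assoc (γ * g), hh.mul_nW hp hw', hinv]; group
  have hbn : ∀ x y, bb J Γ B (c * nW p ((h⁻¹).1 *ᵥ w)) (c.1 *ᵥ ((h⁻¹).1 *ᵥ x))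
      (c.1 *ᵥ ((h⁻¹).1 *ᵥ y)) = bb J Γ B (g * nW p w) (g.1 *ᵥ x) (g.1 *ᵥ y) := by
    intro x y
    rw [hcx, hcx, hcn, bb_right hh, bb_equiv hf hγ]
  have hne : c.1 *ᵥ ((h⁻¹).1 *ᵥ u) ≠ 0 := by
    intro h0
    apply hu0
    have : (c⁻¹).1 *ᵥ (c.1 *ᵥ ((h⁻¹).1 *ᵥ u)) = 0 := by rw [h0, Matrix.mulVec_zero]
    rw [Matrix.mulVec_mulVec, sl_inv_mul, Matrix.one_mulVec] at this
    rw [← hinv u, this, Matrix.mulVec_zero]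
  set u' := (h⁻¹).1 *ᵥ u with hu'def
  set α := bb J Γ B c (c.1 *ᵥ u') (c.1 *ᵥ u') with hα
  have hα0 : 0 < α := by
    refine lt_of_lt_of_le ?_ (bb_lower hf hν _)
    refine lt_of_le_of_ne (dotProduct_self_star_nonneg _) ?_
    intro h0
    exact hne (dotProduct_self_eq_zero.1 h0.symm)
  have hsq : Real.sqrt α * Real.sqrt α = α := Real.mul_self_sqrt hα0.le
  have hsq0 : Real.sqrt α ≠ 0 := (Real.sqrt_pos.2 hα0).ne'
  rw [← hbc]
  refine hρ c _ ((Real.sqrt α)⁻¹ • u') hν hc hc' hw' ?_ ?_ ?_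
  · intro i hi hip
    rw [Pi.smul_apply, hu' i hi hip, smul_zero]
  · rw [Matrix.mulVec_smul, bb_smul_left, bb_smul_right, ← hα]
    have : (Real.sqrt α)⁻¹ * ((Real.sqrt α)⁻¹ * (Real.sqrt α * Real.sqrt α)) = 1 := by
      field_simp
    rwa [hsq] at this
  · intro y hy
    have hy' : InY J p (h.1 *ᵥ y) := fun i hi hip => by
      rw [hh.mulVec_apply _ hi, hy i hi hip]
    rw [Matrix.mulVec_smul, bb_smul_right, bb_smul_right]
    have := hdeg _ hy'
    rw [← hbc, ← hbn, hinv'] at this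
    rw [this]

theorem lemmaB (hf : FinHyp J Γ) (hcoc : CocHyp J Γ B) (hp : J p) (i0 : Fin n) (hi0 : ¬ J i0)
    (ρ0 : ℝ) :
    ∃ ρ : ℝ, ∀ (g : SLn n) (w : Fin n → ℝ) (s : ℝ), |s| ≤ 1 → InW J w →
      bb J Γ B (g * nW p (s • w)) (g.1 *ᵥ w) (g.1 *ᵥ w) ≤ ρ0 →
      bb J Γ B g (g.1 *ᵥ w) (g.1 *ᵥ w) ≤ ρ := by
  obtain ⟨R, hR, hrep⟩ := exists_rep (J := J) (Γ := Γ) i0 hi0 hcoc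
  set a : ℝ := 1 + |ρ0| with ha
  have ha0 : 0 ≤ a := by positivity
  have haρ : ρ0 ≤ a ^ 2 := by
    have h1 := le_abs_self ρ0
    have h2 := abs_nonneg ρ0
    rw [ha]; nlinarith
  obtain ⟨κ, hκ, hκb⟩ := exists_kappa (B := B) hf (R + a)
  refine ⟨n * (a * (n * (κ * a))), fun g w s hs hw hle => ?_⟩
  have hsw : InW J (s • w) := fun i hi => by rw [Pi.smul_apply, hw i hi, smul_zero]
  have hsw' : InW J (-(s • w)) := fun i hi => by rw [Pi.neg_apply, hsw i hi, neg_zero]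
  obtain ⟨γ, hγ, h, hh, hν, hc, hc'⟩ := hrep (g * nW p (s • w))
  set c := γ * (g * nW p (s • w)) * h with hcdef
  have hxb : ∀ i, |(γ.1 *ᵥ (g.1 *ᵥ w)) i| ≤ a := by
    refine abs_le_of_dot_le ?_ ha0
    refine (bb_lower hf hν _).trans (le_trans ?_ haρ)
    rw [hcdef, bb_right hh, bb_equiv hf hγ]; exact hle
  have hc'' : ∀ x, (γ * g * h).1 *ᵥ x = c.1 *ᵥ x - (s * x p) • (γ.1 *ᵥ (g.1 *ᵥ w)) := by
    intro x
    rw [hcdef]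
    simp only [sl_mulVec_mulVec]
    rw [nW_mulVec (hsw p hp), hh.mulVec_apply _ hp, Matrix.mulVec_add, Matrix.mulVec_add,
      smul_smul, Matrix.mulVec_smul, Matrix.mulVec_smul, mul_comm s]
    simp
  have hb : ∀ i j, |(γ * g * h).1 i j| ≤ R + a := by
    intro i j
    have e : (γ * g * h).1 i j = ((γ * g * h).1 *ᵥ Pi.single j 1) i := by
      rw [Matrix.mulVec_single_one]; rfl
    rw [e, hc'', Pi.sub_apply]
    refine (abs_sub _ _).trans (add_le_add ?_ ?_)
    · rw [Matrix.mulVec_single_one]; exact hc i j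
    · rw [Pi.smul_apply, smul_eq_mul, abs_mul]
      have h1 : |s * (Pi.single j 1 : Fin n → ℝ) p| ≤ 1 := by
        rw [abs_mul, Pi.single_apply]
        split_ifs <;> simp [hs]
      calc _ ≤ 1 * a := mul_le_mul h1 (hxb i) (abs_nonneg _) zero_le_one
        _ = a := one_mul a
  rw [← bb_equiv hf hγ, ← bb_right hh]
  exact quad_bound (hκb _ hb) hxb

end Geo4

section Geo5

variable {n : ℕ}

/-- Rotation in the `p, q` plane. -/
noncomputable def rotM (p q : Fin n) (φ : ℝ) : Matrix (Fin n) (Fin n) ℝ := fun i j =>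
  if i = p then (if j = p then Real.cos φ else if j = q then -Real.sin φ else 0)
  else if i = q then (if j = p then Real.sin φ else if j = q then Real.cos φ else 0)
  else if i = j then 1 else 0

theorem rotM_mulVec {p q : Fin n} (hpq : p ≠ q) (φ : ℝ) (x : Fin n → ℝ) (i : Fin n) :
    (rotM p q φ *ᵥ x) i = if i = p then Real.cos φ * x p - Real.sin φ * x q
      else if i = q then Real.sin φ * x p + Real.cos φ * x q else x i := by
  have key : ∀ a b : ℝ, ∑ j, (if j = p then a else if j = q then b else 0) * x j
      = a * x p + b * x q := by
    intro a b
    have : ∀ j, (if j = p then a else if j = q then b else 0) * x j =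
        (if j = p then a * x j else 0) + if j = q then b * x j else 0 := by
      intro j
      by_cases h1 : j = p
      · subst h1; simp [hpq]
      · simp [h1]
    simp only [this, Finset.sum_add_distrib]
    simp
  unfold Matrix.mulVec dotProduct rotM
  by_cases h1 : i = p
  · simp only [h1, if_true, key]; ring
  · by_cases h2 : i = q
    · simp only [h2, hpq.symm, if_true, if_false, key]
    · simp [h1, h2]

theorem rotM_mul {p q : Fin n} (hpq : p ≠ q) (a b : ℝ) :
    rotM p q a * rotM p q b = rotM p q (a + b) := by
  apply Matrix.mulVec_injective
  funext x
  ext i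
  show ((rotM p q a * rotM p q b) *ᵥ x) i = (rotM p q (a + b) *ᵥ x) i
  rw [← Matrix.mulVec_mulVec]
  simp only [rotM_mulVec hpq, Real.cos_add, Real.sin_add, if_true, hpq.symm, if_false]
  split_ifs <;> ring

theorem rotM_zero {p q : Fin n} (hpq : p ≠ q) : rotM p q 0 = 1 := by
  apply Matrix.mulVec_injective
  funext x
  ext i
  show (rotM p q 0 *ᵥ x) i = ((1 : Matrix _ _ ℝ) *ᵥ x) i
  rw [Matrix.one_mulVec, rotM_mulVec hpq]
  split_ifs with h1 h2
  · simp [h1]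
  · simp [h2]
  · rfl

theorem rotM_transpose {p q : Fin n} (hpq : p ≠ q) (a : ℝ) :
    (rotM p q a)ᵀ = rotM p q (-a) := by
  ext i j
  have := hpq.symm
  simp only [Matrix.transpose_apply, rotM, Real.cos_neg, Real.sin_neg, neg_neg]
  by_cases h1 : i = p <;> by_cases h2 : i = q <;> by_cases h3 : j = p <;> by_cases h4 : j = q <;>
    simp_all [eq_comm]

theorem rotM_det {p q : Fin n} (hpq : p ≠ q) (a : ℝ) : (rotM p q a).det = 1 := by
  have h1 : (rotM p q (a / 2)).det * (rotM p q (a / 2)).det = (rotM p q a).det := by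
    rw [← Matrix.det_mul, rotM_mul hpq, add_halves]
  have h2 : (rotM p q (a / 2)).det * (rotM p q (-(a / 2))).det = 1 := by
    rw [← Matrix.det_mul, rotM_mul hpq, add_neg_cancel, rotM_zero hpq, Matrix.det_one]
  rw [← rotM_transpose hpq, Matrix.det_transpose] at h2
  rw [← h1, h2]

/-- Rotation as an element of `SL`. -/
noncomputable def rotS {p q : Fin n} (hpq : p ≠ q) (a : ℝ) : SLn n :=
  ⟨rotM p q a, rotM_det hpq a⟩

theorem rotS_coe {p q : Fin n} (hpq : p ≠ q) (a : ℝ) : (rotS hpq a).1 = rotM p q a := rfl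

theorem rotS_mul {p q : Fin n} (hpq : p ≠ q) (a b : ℝ) :
    rotS hpq a * rotS hpq b = rotS hpq (a + b) := Subtype.ext (rotM_mul hpq a b)

theorem rotS_inv {p q : Fin n} (hpq : p ≠ q) (a : ℝ) :
    ((rotS hpq a)⁻¹).1 = rotM p q (-a) := by
  apply sl_inv_of_mul
  rw [rotS_coe, rotM_mul hpq, neg_add_cancel, rotM_zero hpq]

variable {J : Fin n → Prop} [DecidablePred J] {p q : Fin n}

theorem rotM_DJ (hpq : p ≠ q) (hp : J p) (hq : J q) (a : ℝ) :
    rotM p q a * DJ J = DJ J * rotM p q a := by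
  ext i j
  unfold DJ
  rw [Matrix.mul_diagonal, Matrix.diagonal_mul]
  unfold rotM
  by_cases h1 : i = p <;> by_cases h2 : i = q <;> by_cases h3 : j = p <;> by_cases h4 : j = q <;>
    by_cases h5 : i = j <;> simp_all [eq_comm]

theorem nu_rot (hpq : p ≠ q) (hp : J p) (hq : J q) (a : ℝ) (x : SLn n) :
    nu J (x * rotS hpq a) = nu J x := by
  apply nu_mul_right
  · rw [rotS_coe, rotM_DJ hpq hp hq, rotM_transpose hpq, mul_assoc, rotM_mul hpq, add_neg_cancel,
      rotM_zero hpq, mul_one]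
  · rw [rotS_inv, rotM_transpose hpq, rotM_DJ hpq hp hq, mul_assoc, rotM_mul hpq, neg_add_cancel,
      rotM_zero hpq, mul_one]

theorem rot_pi_nW (hpq : p ≠ q) {w : Fin n → ℝ} (hwp : w p = 0) (hwq : w q = 0) :
    rotS hpq Real.pi * nW p (-w) = nW p w * rotS hpq Real.pi := by
  apply sl_ext_mulVec
  intro x
  rw [sl_mulVec_mulVec, sl_mulVec_mulVec, nW_mulVec (by simp [hwp]), nW_mulVec hwp, rotS_coe]
  ext i
  simp only [rotM_mulVec hpq, Pi.add_apply, Pi.smul_apply, Pi.neg_apply, hwp, hwq, Real.cos_pi,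
    Real.sin_pi, if_true, smul_eq_mul]
  split_ifs with h1 h2
  · simp [h1, hwp]
  · simp [h2, hwq]
  · ring

theorem rot_fix (hpq : p ≠ q) {w : Fin n → ℝ} (hwp : w p = 0) (hwq : w q = 0) (a : ℝ) :
    rotM p q a *ᵥ w = w := by
  ext i
  rw [rotM_mulVec hpq]
  split_ifs with h1 h2
  · simp [h1, hwp, hwq]
  · simp [h2, hwp, hwq]
  · rfl

theorem rotM_pi (hpq : p ≠ q) :
    rotM p q Real.pi = Matrix.diagonal fun i => if i = p ∨ i = q then (-1 : ℝ) else 1 := by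
  ext i j
  have := hpq.symm
  rw [Matrix.diagonal_apply]
  unfold rotM
  by_cases h1 : i = p <;> by_cases h2 : i = q <;> by_cases h3 : j = p <;> by_cases h4 : j = q <;>
    by_cases h5 : i = j <;> simp_all [eq_comm]

theorem continuous_rotM (p q : Fin n) : Continuous (rotM p q) := by
  refine continuous_matrix fun i j => ?_
  unfold rotM
  split_ifs <;> fun_prop

theorem continuous_nW (p : Fin n) : Continuous (nW p : (Fin n → ℝ) → SLn n) := by
  apply continuous_sl_of
  show Continuous fun w : Fin n → ℝ =>
    (1 : Matrix (Fin n) (Fin n) ℝ) + Matrix.vecMulVec (Function.update w p 0) (Pi.single p 1)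
  have h : Continuous fun w : Fin n → ℝ => Function.update w p 0 :=
    continuous_id.update p continuous_const
  exact continuous_const.add (h.matrix_vecMulVec continuous_const)

theorem continuous_sl_mul {X : Type*} [TopologicalSpace X] {f g : X → SLn n}
    (hf : Continuous f) (hg : Continuous g) : Continuous fun x => f x * g x := by
  apply continuous_sl_of
  simp only [Matrix.SpecialLinearGroup.coe_mul]
  exact (continuous_slCoe.comp hf).matrix_mul (continuous_slCoe.comp hg)

variable {Γ : Subgroup (SLn n)} {B : ℝ}

variable (J Γ B) in
/-- Difference of the averaged forms, pulled back by the rotation. -/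
noncomputable def KM (hpq : p ≠ q) (φ : ℝ) (w1 w2 : Fin n → ℝ) : Matrix (Fin n) (Fin n) ℝ :=
  (rotM p q φ)ᵀ * (SS J Γ B (rotS hpq φ * nW p w1) - SS J Γ B (rotS hpq φ * nW p w2)) *
    rotM p q φ

theorem KM_swap (hpq : p ≠ q) (φ : ℝ) (w1 w2 : Fin n → ℝ) :
    KM J Γ B hpq φ w2 w1 = -KM J Γ B hpq φ w1 w2 := by
  unfold KM
  rw [← neg_sub, Matrix.mul_neg, Matrix.neg_mul]

theorem KM_symm (hf : FinHyp J Γ) (hpq : p ≠ q) (φ : ℝ) (w1 w2 : Fin n → ℝ) :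
    (KM J Γ B hpq φ w1 w2)ᵀ = KM J Γ B hpq φ w1 w2 := by
  unfold KM
  simp only [Matrix.transpose_mul, Matrix.transpose_transpose, Matrix.transpose_sub,
    SS_symm hf, mul_assoc]

theorem SS_rot_pi (hpq : p ≠ q) (hp : J p) (hq : J q) (φ : ℝ) {w : Fin n → ℝ} (hw : InW J w) :
    SS J Γ B (rotS hpq (φ + Real.pi) * nW p (-w)) = SS J Γ B (rotS hpq φ * nW p w) := by
  rw [← rotS_mul, mul_assoc, rot_pi_nW hpq (hw p hp) (hw q hq), ← mul_assoc,
    SS_right _ _ (nu_rot hpq hp hq Real.pi)]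

theorem KM_pi (hpq : p ≠ q) (hp : J p) (hq : J q) (φ : ℝ) {w1 w2 : Fin n → ℝ}
    (hw1 : InW J w1) (hw2 : InW J w2) :
    KM J Γ B hpq (φ + Real.pi) (-w1) (-w2) =
      rotM p q Real.pi * KM J Γ B hpq φ w1 w2 * rotM p q Real.pi := by
  unfold KM
  rw [SS_rot_pi hpq hp hq φ hw1, SS_rot_pi hpq hp hq φ hw2]
  have h1 : rotM p q (φ + Real.pi) = rotM p q φ * rotM p q Real.pi := (rotM_mul hpq _ _).symm
  have h2 : (rotM p q Real.pi)ᵀ = rotM p q Real.pi := by rw [rotM_pi hpq, Matrix.diagonal_transpose]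
  rw [h1, Matrix.transpose_mul, h2]
  simp only [mul_assoc]

theorem KM_dot (hpq : p ≠ q) (φ : ℝ) (w1 w2 x y : Fin n → ℝ) :
    x ⬝ᵥ (KM J Γ B hpq φ w1 w2 *ᵥ y) =
      bb J Γ B (rotS hpq φ * nW p w1) (rotM p q φ *ᵥ x) (rotM p q φ *ᵥ y) -
      bb J Γ B (rotS hpq φ * nW p w2) (rotM p q φ *ᵥ x) (rotM p q φ *ᵥ y) := by
  unfold KM bb
  rw [← Matrix.mulVec_mulVec, ← Matrix.mulVec_mulVec, Matrix.dotProduct_mulVec,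
    Matrix.vecMul_transpose, Matrix.sub_mulVec, dotProduct_sub]

theorem KM_continuous (hf : FinHyp J Γ) (hpq : p ≠ q) {X : Type*} [TopologicalSpace X]
    {φ : X → ℝ} {w1 w2 : X → Fin n → ℝ} (hφ : Continuous φ) (h1 : Continuous w1)
    (h2 : Continuous w2) : Continuous fun x => KM J Γ B hpq (φ x) (w1 x) (w2 x) := by
  unfold KM
  have hr : Continuous fun x => rotM p q (φ x) := (continuous_rotM p q).comp hφ
  have hrs : Continuous fun x => rotS hpq (φ x) := continuous_sl_of hr
  have c1 := (SS_continuous (B := B) hf).comp (continuous_sl_mul hrs ((continuous_nW p).comp h1))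
  have c2 := (SS_continuous (B := B) hf).comp (continuous_sl_mul hrs ((continuous_nW p).comp h2))
  exact (hr.matrix_transpose.matrix_mul (c1.sub c2)).matrix_mul hr

/-- The index set of the block on which the form difference is considered. -/
abbrev YIdx (J : Fin n → Prop) (p : Fin n) := {i : Fin n // ¬ J i ∨ i = p}

/-- The circle of vectors. -/
noncomputable def wv (i0 i1 : Fin n) (r : ℝ) (ψ : ℝ) : Fin n → ℝ :=
  Pi.single i0 (r * Real.cos ψ) + Pi.single i1 (r * Real.sin ψ)

theorem core_contra (hf : FinHyp J Γ) (hcoc : CocHyp J Γ B) (hpq : p ≠ q) (hp : J p) (hq : J q)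
    (i0 i1 : Fin n) (hi0 : ¬ J i0) (hi1 : ¬ J i1) (h01 : i0 ≠ i1) : False := by
  obtain ⟨ρ0, hA⟩ := lemmaA hf hcoc hp i0 hi0
  obtain ⟨ρ1, hB⟩ := lemmaB hf hcoc hp i0 hi0 ρ0
  obtain ⟨γ0, hγ0, hν0⟩ := hcoc 1
  obtain ⟨D, hD, hDb⟩ := finite_inv_bound (Set.finite_singleton (⟨γ0, hγ0⟩ : Γ))
  have hDb := hDb _ rfl
  set a : ℝ := 1 + |ρ1| with ha
  have ha0 : 0 ≤ a := by positivity
  have haρ : ρ1 ≤ a ^ 2 := by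
    have h1 := le_abs_self ρ1
    have h2 := abs_nonneg ρ1
    rw [ha]; nlinarith
  set b : ℝ := n * (D * a) with hb
  have hb0 : 0 ≤ b := by positivity
  set r : ℝ := 2 * b + 1 with hr
  have hwW : ∀ ψ, InW J (wv i0 i1 r ψ) := by
    intro ψ i hi
    have e0 : i ≠ i0 := fun e => hi0 (e ▸ hi)
    have e1 : i ≠ i1 := fun e => hi1 (e ▸ hi)
    simp [wv, e0, e1]
  have hbig : ∀ ψ, ¬ bb J Γ B 1 (wv i0 i1 r ψ) (wv i0 i1 r ψ) ≤ ρ1 := by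
    intro ψ hle
    have h1 := (SS_lower hf 1 γ0 hγ0 hν0 (wv i0 i1 r ψ)).trans (hle.trans haρ)
    have h2 := abs_le_of_dot_le h1 ha0
    have h3 : ∀ i, |wv i0 i1 r ψ i| ≤ b := by
      intro i
      have e : wv i0 i1 r ψ = (γ0⁻¹).1 *ᵥ (γ0.1 *ᵥ wv i0 i1 r ψ) := by
        rw [Matrix.mulVec_mulVec, sl_inv_mul, Matrix.one_mulVec]
      rw [e]
      exact mulVec_bound hDb h2 i
    have e0 : wv i0 i1 r ψ i0 = r * Real.cos ψ := by simp [wv, h01]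
    have e1 : wv i0 i1 r ψ i1 = r * Real.sin ψ := by simp [wv, h01.symm]
    have f0 := h3 i0
    have f1 := h3 i1
    rw [e0] at f0
    rw [e1] at f1
    have g0 := sq_le_sq' (abs_le.1 f0).1 (abs_le.1 f0).2
    have g1 := sq_le_sq' (abs_le.1 f1).1 (abs_le.1 f1).2
    have : r ^ 2 = (r * Real.cos ψ) ^ 2 + (r * Real.sin ψ) ^ 2 := by
      have := Real.sin_sq_add_cos_sq ψ
      linear_combination (-r ^ 2) * this
    nlinarith
  have hsm : ∀ (c : ℝ) {w : Fin n → ℝ}, InW J w → InW J (c • w) := by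
    intro c w hw i hi
    rw [Pi.smul_apply, hw i hi, smul_zero]
  let e : YIdx J p → Fin n := Subtype.val
  let R : Matrix (YIdx J p) (YIdx J p) ℝ :=
    Matrix.diagonal fun i => if (i : Fin n) = p ∨ (i : Fin n) = q then (-1 : ℝ) else 1
  have hiq : ∀ i : YIdx J p, (i : Fin n) ≠ q := by
    rintro ⟨i, hi⟩ rfl
    rcases hi with h | h
    · exact h hq
    · exact hpq h.symm
  have hsub : ∀ X : Matrix (Fin n) (Fin n) ℝ,
      (rotM p q Real.pi * X * rotM p q Real.pi).submatrix e e = R * X.submatrix e e * R := by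
    intro X
    ext i j
    rw [rotM_pi hpq, Matrix.submatrix_apply, Matrix.mul_diagonal, Matrix.diagonal_mul,
      Matrix.mul_diagonal, Matrix.diagonal_mul]
    rfl
  let w : ℝ → Fin n → ℝ := fun t => wv i0 i1 r (Real.pi * t)
  have hw1 : w 1 = -w 0 := by
    simp only [w, wv, mul_one, mul_zero, Real.cos_pi, Real.sin_pi, Real.cos_zero, Real.sin_zero]
    simp [Pi.single_neg]
  let K : ℝ → ℝ → Matrix (YIdx J p) (YIdx J p) ℝ := fun s t =>
    (KM J Γ B hpq (Real.pi * (t + s)) ((1 - s) • w t) ((-s) • w t)).submatrix e e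
  have hwc : Continuous w := by
    refine continuous_pi fun i => ?_
    simp only [w, wv, Pi.add_apply, Pi.single_apply]
    split_ifs <;> fun_prop
  refine symmetric_family_contra R ?_ ?_ ?_ K ?_ ?_ ?_ ?_ ?_
  · rw [Matrix.diagonal_mul_diagonal, ← Matrix.diagonal_one]
    congr 1
    funext i
    split_ifs <;> norm_num
  · rw [Matrix.diagonal_transpose]
  · rw [Matrix.det_diagonal, Finset.prod_eq_single (⟨p, Or.inr rfl⟩ : YIdx J p)]
    · simp
    · intro i _ hi
      have : (i : Fin n) ≠ p := fun e => hi (Subtype.ext e)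
      simp [this, hiq i]
    · intro h; exact absurd (Finset.mem_univ _) h
  · refine Continuous.matrix_submatrix (KM_continuous hf hpq ?_ ?_ ?_) e e
    · fun_prop
    · have : Continuous fun x : ℝ × ℝ => w x.2 := hwc.comp continuous_snd
      fun_prop
    · have : Continuous fun x : ℝ × ℝ => w x.2 := hwc.comp continuous_snd
      fun_prop
  · intro s t
    show (Matrix.submatrix _ e e)ᵀ = _
    rw [Matrix.transpose_submatrix, KM_symm hf]
  · intro s hs t hdet
    obtain ⟨v, hv0, hv⟩ := Matrix.exists_mulVec_eq_zero_iff.2 hdet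
    set φ := Real.pi * (t + s) with hφ
    set u : Fin n → ℝ := fun i => if h : ¬ J i ∨ i = p then v ⟨i, h⟩ else 0 with hu
    have huY : InY J p u := by
      intro i hi hip
      have : ¬ (¬ J i ∨ i = p) := by tauto
      simp only [hu]
      rw [dif_neg this]
    have hu0 : u ≠ 0 := by
      intro h0
      apply hv0
      funext i
      have := congrFun h0 i.1
      simp only [hu] at this
      rw [dif_pos i.2] at this
      exact this
    have hsum : ∀ f : Fin n → ℝ, (∀ i, J i → i ≠ p → f i = 0) →
        ∑ i, f i = ∑ i : YIdx J p, f i.1 := by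
      intro f hf0
      have h1 : ∑ i ∈ Finset.univ.filter (fun i => ¬ J i ∨ i = p), f i = ∑ i, f i := by
        refine Finset.sum_subset (Finset.subset_univ _) fun i _ hi => ?_
        have hi' : ¬ (¬ J i ∨ i = p) := fun h => hi (Finset.mem_filter.2 ⟨Finset.mem_univ _, h⟩)
        exact hf0 i (by tauto) (by tauto)
      rw [← h1]
      exact Finset.sum_subtype _ (fun i => by simp) f
    have hKu : ∀ y, InY J p y →
        y ⬝ᵥ (KM J Γ B hpq φ ((1 - s) • w t) ((-s) • w t) *ᵥ u) = 0 := by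
      intro y hy
      unfold dotProduct
      refine Finset.sum_eq_zero fun i _ => ?_
      by_cases hi : ¬ J i ∨ i = p
      · have h1 := congrFun hv ⟨i, hi⟩
        have h2 : (KM J Γ B hpq φ ((1 - s) • w t) ((-s) • w t) *ᵥ u) i = 0 := by
          refine Eq.trans ?_ h1
          unfold Matrix.mulVec dotProduct
          rw [hsum _ (fun j hj hjp => by rw [huY j hj hjp, mul_zero])]
          refine Finset.sum_congr rfl fun j _ => ?_
          have : u j.1 = v j := by
            simp only [hu]; rw [dif_pos j.2]
          rw [this]; rfl
        rw [h2, mul_zero]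
      · rw [hy i (by tauto) (by tauto), zero_mul]
    have hwt := hwW (Real.pi * t)
    have hwtp : w t p = 0 := hwt p hp
    have hwtq : w t q = 0 := hwt q hq
    -- apply the two lemmas
    set g : SLn n := rotS hpq φ * nW p ((-s) • w t) with hg
    set m := nW p (s • w t) with hm
    have hmW := hsm s hwt
    have hmm : nW p ((-s) • w t) * m = 1 := by
      rw [hm, nW_mul (hsm (-s) hwt p hp) (hsm s hwt p hp), ← add_smul, neg_add_cancel, zero_smul,
        nW_zero]
    have hgm : g * m = rotS hpq φ := by rw [hg, mul_assoc, hmm, mul_one]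
    have hgmx : ∀ x, g.1 *ᵥ (m.1 *ᵥ x) = rotM p q φ *ᵥ x := by
      intro x; rw [← sl_mulVec_mulVec, hgm]; rfl
    have hgw : g * nW p (w t) = rotS hpq φ * nW p ((1 - s) • w t) := by
      rw [hg, mul_assoc, nW_mul (hsm (-s) hwt p hp) hwtp]
      congr 2
      rw [sub_smul, one_smul, neg_smul]; abel
    have hmY : ∀ y, InY J p y → InY J p (m.1 *ᵥ y) := by
      intro y hy i hi hip
      rw [hm, nW_mulVec (hmW p hp), Pi.add_apply, hy i hi hip, Pi.smul_apply, hmW i hi]; simp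
    have hm0 : m.1 *ᵥ u ≠ 0 := by
      intro h0
      apply hu0
      have : (m⁻¹).1 *ᵥ (m.1 *ᵥ u) = 0 := by rw [h0, Matrix.mulVec_zero]
      rwa [Matrix.mulVec_mulVec, sl_inv_mul, Matrix.one_mulVec] at this
    have h1 := hA g (w t) (m.1 *ᵥ u) hwt (hmY u huY) hm0 (by
      intro y hy
      have hy' : ∃ y', InY J p y' ∧ m.1 *ᵥ y' = y := by
        refine ⟨(nW p ((-s) • w t)).1 *ᵥ y, ?_, ?_⟩
        · intro i hi hip
          rw [nW_mulVec (hsm (-s) hwt p hp), Pi.add_apply, hy i hi hip, Pi.smul_apply,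
            hsm (-s) hwt i hi]
          simp
        · rw [← sl_mulVec_mulVec, hm, nW_mul (hsm s hwt p hp) (hsm (-s) hwt p hp), ← add_smul,
            add_neg_cancel, zero_smul, nW_zero]
          exact Matrix.one_mulVec y
      obtain ⟨y', hy'1, rfl⟩ := hy'
      have := hKu y' hy'1
      rw [KM_dot] at this
      rw [hgw, hgmx, hgmx]
      linarith)
    have hgwt : g.1 *ᵥ w t = (rotS hpq φ).1 *ᵥ w t := by
      rw [hg, sl_mulVec_mulVec, nW_mulVec (hsm (-s) hwt p hp), hwtp, zero_smul, add_zero]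
    rw [hgwt] at h1
    have h2 := hB (rotS hpq φ) (w t) (-s) (by
      rw [abs_neg, abs_of_nonneg hs.1]; exact hs.2) hwt h1
    rw [rotS_coe, rot_fix hpq hwtp hwtq] at h2
    apply hbig (Real.pi * t)
    have h3 : bb J Γ B (1 * rotS hpq φ) (w t) (w t) = bb J Γ B 1 (w t) (w t) := by
      unfold bb
      rw [SS_right _ _ (nu_rot hpq hp hq φ)]
    rw [one_mul] at h3
    rw [h3] at h2
    exact h2
  · intro s
    show Matrix.submatrix _ e e = R * Matrix.submatrix _ e e * R
    rw [← hsub, hw1]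
    have e1 : Real.pi * (1 + s) = Real.pi * (0 + s) + Real.pi := by ring
    rw [e1, smul_neg, smul_neg, KM_pi hpq hp hq _ (hsm _ (hwW _)) (hsm _ (hwW _))]
  · intro t
    show Matrix.submatrix _ e e = -(R * Matrix.submatrix _ e e * R)
    rw [← hsub]
    have e1 : Real.pi * (t + 1) = Real.pi * (t + 0) + Real.pi := by ring
    have e2 : (1 - 1 : ℝ) • w t = -(0 : Fin n → ℝ) := by simp
    have e3 : (-1 : ℝ) • w t = -(w t) := by simp
    have e4 : (1 - 0 : ℝ) • w t = w t := by simp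
    have e5 : (-0 : ℝ) • w t = 0 := by simp
    have z0 : InW J (0 : Fin n → ℝ) := fun i _ => rfl
    have z1 : InW J (w t) := hwW _
    rw [e1, e2, e3, e4, e5, KM_pi hpq hp hq _ z0 z1, KM_swap hpq _ (w t) 0]
    simp
    rfl

end Geo5

/-- **Labourie–Zimmer.**  Let `k ≥ 3`, `n ≥ k + 2`, and let `H` be the upper-left embedded
copy of `SL(n−k, ℝ)` in `SL(n, ℝ)` (block matrices `diag(A, I_k)`).  No discrete subgroup
`Γ` of `SL(n, ℝ)` acts freely, properly discontinuously and cocompactly on `SL(n, ℝ)/H` by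
left multiplication: `SL(n−k,ℝ)\SL(n,ℝ)` has no compact Clifford–Klein form for `k ≥ 3`. -/
theorem labourie_zimmer_no_compact_form (n k : ℕ) (hk : 3 ≤ k) (hn : k + 2 ≤ n)
    (H : Subgroup (Matrix.SpecialLinearGroup (Fin n) ℝ))
    (hH : (H : Set (Matrix.SpecialLinearGroup (Fin n) ℝ)) =
      {g : Matrix.SpecialLinearGroup (Fin n) ℝ | ∀ i j : Fin n,
        (n - k ≤ (i : ℕ) ∨ n - k ≤ (j : ℕ)) →
        (g : Matrix (Fin n) (Fin n) ℝ) i j = if i = j then 1 else 0})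
    (Γ : Subgroup (Matrix.SpecialLinearGroup (Fin n) ℝ))
    (hdisc : DiscreteTopology Γ) :
    ¬ ((∀ γ : Γ, (∃ x : Matrix.SpecialLinearGroup (Fin n) ℝ ⧸ H,
          (γ : Matrix.SpecialLinearGroup (Fin n) ℝ) • x = x) → γ = 1) ∧
        (∀ K L : Set (Matrix.SpecialLinearGroup (Fin n) ℝ ⧸ H),
          IsCompact K → IsCompact L →
          {γ : Γ | ∃ x ∈ K, ((γ : Matrix.SpecialLinearGroup (Fin n) ℝ) • x) ∈ L}.Finite) ∧
        (∃ K : Set (Matrix.SpecialLinearGroup (Fin n) ℝ ⧸ H), IsCompact K ∧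
          ∀ x : Matrix.SpecialLinearGroup (Fin n) ℝ ⧸ H, ∃ γ ∈ Γ, ∃ y ∈ K, γ • y = x)) := by
  classical
  rintro ⟨-, hprop, K, hK, hcov⟩
  let J : Fin n → Prop := fun i => n - k ≤ (i : ℕ)
  let i0 : Fin n := ⟨0, by omega⟩
  let i1 : Fin n := ⟨1, by omega⟩
  let p : Fin n := ⟨n - 1, by omega⟩
  let q : Fin n := ⟨n - 2, by omega⟩
  have hi0 : ¬ J i0 := by show ¬ (n - k ≤ 0); omega
  have hi1 : ¬ J i1 := by show ¬ (n - k ≤ 1); omega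
  have hp : J p := by show n - k ≤ n - 1; omega
  have hq : J q := by show n - k ≤ n - 2; omega
  have hpq : p ≠ q := by
    intro h
    have := congrArg Fin.val h
    change n - 1 = n - 2 at this
    omega
  have h01 : i0 ≠ i1 := by
    intro h
    have := congrArg Fin.val h
    change 0 = 1 at this
    omega
  have hmem : ∀ h : SLn n, h ∈ H ↔ InH J h := by
    intro h
    rw [← SetLike.mem_coe, hH]
    exact Iff.rfl
  have hmk : ∀ g h : SLn n, InH J h → (QuotientGroup.mk (g * h) : SLn n ⧸ H) =
      QuotientGroup.mk g := fun g h hh => QuotientGroup.mk_mul_of_mem g ((hmem h).2 hh)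
  have hf : FinHyp J Γ := by
    intro C
    obtain ⟨R, hR, hqr⟩ := qr_lemma (J := J) i0 hi0 C
    have hcpt : IsCompact ((QuotientGroup.mk : SLn n → SLn n ⧸ H) ''
        {g : SLn n | ∀ i j, |g.1 i j| ≤ R}) :=
      (isCompact_slBox R).image continuous_quotient_mk'
    refine (hprop _ _ hcpt hcpt).subset ?_
    rintro γ ⟨g, hg1, hg2⟩
    obtain ⟨h, hh, hb⟩ := hqr _ hg1
    obtain ⟨h', hh', hb'⟩ := hqr _ hg2
    refine ⟨QuotientGroup.mk g, ⟨g * h, fun i j => (hb i j).1, hmk g h hh⟩, ?_⟩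
    exact ⟨γ.1 * g * h', fun i j => (hb' i j).1, hmk _ _ hh'⟩
  obtain ⟨B, hcoc⟩ : ∃ B, CocHyp J Γ B := by
    have hlift : ∀ a b : SLn n, (QuotientGroup.leftRel H) a b → nu J a = nu J b := by
      intro a b hab
      rw [QuotientGroup.leftRel_apply] at hab
      have := ((hmem _).1 hab).nu_mul a
      rw [mul_inv_cancel_left] at this
      exact this.symm
    let nuQ : SLn n ⧸ H → ℝ := Quotient.lift (nu J) hlift
    have hcont : Continuous nuQ := Continuous.quotient_lift nu_continuous hlift
    obtain ⟨C, hC⟩ := (hK.image hcont).bddAbove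
    refine ⟨C + 1, fun g => ?_⟩
    obtain ⟨γ, hγ, y, hy, hyx⟩ := hcov (QuotientGroup.mk g)
    refine ⟨γ⁻¹, Γ.inv_mem hγ, ?_⟩
    have hy2 : y = QuotientGroup.mk (γ⁻¹ * g) := by
      rw [← inv_smul_eq_iff.2 hyx.symm]; rfl
    have := hC ⟨y, hy, rfl⟩
    rw [hy2] at this
    have h2 : nuQ (QuotientGroup.mk (γ⁻¹ * g)) = nu J (γ⁻¹ * g) := rfl
    rw [h2] at this
    linarith
  exact core_contra hf hcoc hpq hp hq i0 i1 hi0 hi1 h01
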